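/- arXiv:2307.04369 — 5 statements merged into one kernel-verified Lean document; each statement's English description precedes it below -/
import Mathlib

section
/- For every integer n ≥ 8, the maximum number of triangles in an n-vertex graph containing no copy of the suspension of P4 is exactly ⌊n²/8⌋; that is, ex(n, K₃, P̂₄) = ⌊n²/8⌋. -/
/-- `H` is contained in `G` as a (not necessarily induced) subgraph:
there is an injective map of vertices carrying edges of `H` to edges of `G`. -/
def Contains {α β : Type*} (H : SimpleGraph α) (G : SimpleGraph β) : Prop :=
  ∃ f : α → β, Function.Injective f ∧ ∀ ⦃a b⦄, H.Adj a b → G.Adj (f a) (f b)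

/-- The suspension `P̂₄` of the path on 4 vertices: a new apex vertex `none`
is joined to all four vertices of `P₄`. -/
def hatP4 : SimpleGraph (Option (Fin 4)) :=
  SimpleGraph.fromRel (fun a b =>
    (∃ i j, a = some i ∧ b = some j ∧ (SimpleGraph.pathGraph 4).Adj i j) ∨ a = none)

/-- The number of triangles (3-cliques) of a graph. -/
noncomputable def triangleCount {V : Type*} (G : SimpleGraph V) : ℕ :=
  (G.cliqueSet 3).ncard

/-- No vertex neighbourhood contains a path on four vertices. -/
def LinkP4Free {V : Type*} (G : SimpleGraph V) : Prop :=
  ∀ v a b c d, a ≠ c → a ≠ d → b ≠ d → G.Adj v a → G.Adj v b → G.Adj v c → G.Adj v d →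
    G.Adj a b → G.Adj b c → G.Adj c d → False

section Counting

open Finset Classical

variable {V : Type*} (G : SimpleGraph V)

/-- Indicator of the event that `x, y, z` span a triangle. -/
noncomputable def tri (x y z : V) : ℝ :=
  if G.Adj x y ∧ G.Adj y z ∧ G.Adj x z then 1 else 0

/-- Number of ordered triangles in `A × B × C`. -/
noncomputable def triSum (A B C : Finset V) : ℝ :=
  ∑ x ∈ A, ∑ y ∈ B, ∑ z ∈ C, tri G x y z

/-- Number of neighbours of `x` in `S`. -/
noncomputable def degIn (S : Finset V) (x : V) : ℕ := #{y ∈ S | G.Adj x y}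

/-- Number of common neighbours of `x` and `y` in `S`. -/
noncomputable def codegIn (S : Finset V) (x y : V) : ℕ := #{z ∈ S | G.Adj x z ∧ G.Adj y z}

variable {G}

lemma tri_comm_left (x y z : V) : tri G x y z = tri G y x z := by
  unfold tri; congr 1; simp only [G.adj_comm x y, eq_iff_iff]; tauto

lemma tri_comm_right (x y z : V) : tri G x y z = tri G x z y := by
  unfold tri; congr 1; simp only [G.adj_comm z y, eq_iff_iff]; tauto

lemma tri_mul_le {x y z : V} {a b : ℝ}
    (h : G.Adj x y → G.Adj y z → G.Adj x z → a ≤ b) : tri G x y z * a ≤ tri G x y z * b := by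
  unfold tri
  split_ifs with ht
  · simpa using h ht.1 ht.2.1 ht.2.2
  · simp

lemma tri_le_mul {x y z : V} {b : ℝ}
    (h : G.Adj x y → G.Adj y z → G.Adj x z → 1 ≤ b) : tri G x y z ≤ tri G x y z * b := by
  simpa using tri_mul_le (a := 1) h

lemma triSum_comm_left (A B C : Finset V) : triSum G A B C = triSum G B A C := by
  unfold triSum
  rw [sum_comm]
  simp only [tri_comm_left]

lemma triSum_comm_right (A B C : Finset V) : triSum G A B C = triSum G A C B := by
  unfold triSum
  refine sum_congr rfl fun x _ => ?_
  rw [sum_comm]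
  exact sum_congr rfl fun y _ => sum_congr rfl fun z _ => tri_comm_right _ _ _

lemma codegIn_comm (S : Finset V) (x y : V) : codegIn G S x y = codegIn G S y x := by
  unfold codegIn; simp only [and_comm]

lemma sum_tri (S : Finset V) (x y : V) :
    ∑ z ∈ S, tri G x y z = if G.Adj x y then (codegIn G S x y : ℝ) else 0 := by
  unfold tri codegIn
  split_ifs with h
  · simp [h, and_comm]
  · simp [h]

lemma sum_tri_div_codegIn_le (S : Finset V) (x y : V) :
    ∑ z ∈ S, tri G x y z * (1 / codegIn G S x y : ℝ) ≤ if G.Adj x y then 1 else 0 := by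
  rw [← sum_mul, sum_tri]
  split_ifs
  · rw [mul_one_div]; exact div_self_le_one _
  · simp

lemma codegIn_pos {S : Finset V} {x y z : V} (hz : z ∈ S) (hxz : G.Adj x z) (hyz : G.Adj y z) :
    1 ≤ codegIn G S x y :=
  card_pos.2 ⟨z, mem_filter.2 ⟨hz, hxz, hyz⟩⟩

lemma exists_ne_of_codegIn {S : Finset V} {x y : V} (h : 2 ≤ codegIn G S x y) (z : V) :
    ∃ w ∈ S, G.Adj x w ∧ G.Adj y w ∧ w ≠ z := by
  obtain ⟨w, hw, hne⟩ := exists_mem_ne (show 1 < #{z ∈ S | G.Adj x z ∧ G.Adj y z} from h) z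
  rw [mem_filter] at hw
  exact ⟨w, hw.1, hw.2.1, hw.2.2, hne⟩

lemma exists_ne_ne_of_codegIn {S : Finset V} {x y : V} (h : 3 ≤ codegIn G S x y) (z z' : V) :
    ∃ w ∈ S, G.Adj x w ∧ G.Adj y w ∧ w ≠ z ∧ w ≠ z' := by
  have h1 : 1 < #({z ∈ S | G.Adj x z ∧ G.Adj y z}.erase z) := by
    have := pred_card_le_card_erase (s := {z ∈ S | G.Adj x z ∧ G.Adj y z}) (a := z)
    unfold codegIn at h
    omega
  obtain ⟨w, hw, hne⟩ := exists_mem_ne h1 z'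
  rw [mem_erase, mem_filter] at hw
  exact ⟨w, hw.2.1, hw.2.2.1, hw.2.2.2, hw.1, hne⟩

lemma LinkP4Free.codegIn_lt (hG : LinkP4Free G) {S : Finset V} {x y z : V}
    (hxy : G.Adj x y) (hyz : G.Adj y z) (hxz : G.Adj x z)
    (h2 : 2 ≤ codegIn G S x z) : codegIn G S x y < 3 := by
  by_contra! h3
  obtain ⟨s, -, hxs, hzs, hsy⟩ := exists_ne_of_codegIn h2 y
  obtain ⟨p, -, hxp, hyp, hpz, hps⟩ := exists_ne_ne_of_codegIn h3 z s
  exact hG x p y z s hpz hps hsy.symm hxp hxy hxz hxs hyp.symm hyz hzs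

lemma LinkP4Free.one_le_inv_add_inv (hG : LinkP4Free G) {S : Finset V} {x y z : V}
    (hy : y ∈ S) (hz : z ∈ S) (hxy : G.Adj x y) (hyz : G.Adj y z) (hxz : G.Adj x z) :
    (1 : ℝ) ≤ 1 / codegIn G S x y + 1 / codegIn G S x z := by
  have h1 := codegIn_pos hz hxz hyz
  have h2 := codegIn_pos hy hxy hyz.symm
  have h3 := hG.codegIn_lt (S := S) hxy hyz hxz
  have h4 := hG.codegIn_lt (S := S) hxz hyz.symm hxy
  have hc : codegIn G S x y = 1 ∨ codegIn G S x z = 1 ∨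
      (codegIn G S x y = 2 ∧ codegIn G S x z = 2) := by omega
  rcases hc with h | h | ⟨h, h'⟩
  · rw [h]; norm_num
  · rw [h]; norm_num
  · rw [h, h']; norm_num

/-- Discharging bound for the number of edges in the link of `x`. -/
lemma link_sum_le_of_weight {S : Finset V} {x : V} (b : V → ℝ)
    (hb : ∀ y ∈ S, ∀ z ∈ S, G.Adj x y → G.Adj y z → G.Adj x z → 1 ≤ b y + b z) :
    ∑ y ∈ S, ∑ z ∈ S, tri G x y z ≤ 2 * ∑ y ∈ S with G.Adj x y, b y * codegIn G S x y := by
  have h1 : ∑ y ∈ S, ∑ z ∈ S, tri G x y z ≤ ∑ y ∈ S, ∑ z ∈ S, tri G x y z * (b y + b z) :=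
    sum_le_sum fun y hy => sum_le_sum fun z hz => tri_le_mul (hb y hy z hz)
  have h2 : ∑ y ∈ S, ∑ z ∈ S, tri G x y z * b z = ∑ y ∈ S, ∑ z ∈ S, tri G x y z * b y := by
    rw [sum_comm]
    exact sum_congr rfl fun y _ => sum_congr rfl fun z _ => by rw [tri_comm_right]
  have h3 : ∑ y ∈ S, ∑ z ∈ S, tri G x y z * b y =
      ∑ y ∈ S with G.Adj x y, b y * codegIn G S x y := by
    rw [sum_filter]
    refine sum_congr rfl fun y _ => ?_
    rw [← sum_mul, sum_tri]
    split_ifs <;> ring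
  simp only [mul_add, sum_add_distrib] at h1
  linarith

lemma LinkP4Free.link_sum_le (hG : LinkP4Free G) (S : Finset V) (x : V) :
    ∑ y ∈ S, ∑ z ∈ S, tri G x y z ≤ 2 * degIn G S x := by
  refine (link_sum_le_of_weight (fun y => 1 / codegIn G S x y)
    fun y hy z hz hxy hyz hxz => hG.one_le_inv_add_inv hy hz hxy hyz hxz).trans ?_
  unfold degIn
  rw [card_eq_sum_ones, Nat.cast_sum]
  gcongr with y hy
  rw [one_div_mul_eq_div]
  simpa using div_self_le_one (codegIn G S x y : ℝ)

/-- If some neighbour of `x` lies in no triangle of the link, then the link has a star component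
and one edge is saved. -/
lemma LinkP4Free.link_sum_le_sub (hG : LinkP4Free G) {S : Finset V} {x y₀ : V} (hy₀ : y₀ ∈ S)
    (hxy₀ : G.Adj x y₀)
    (hK : ∀ y ∈ S, ∀ z ∈ S, G.Adj x y → G.Adj x z → G.Adj y₀ y → G.Adj y₀ z → ¬ G.Adj y z) :
    ∑ y ∈ S, ∑ z ∈ S, tri G x y z ≤ 2 * degIn G S x - 2 := by
  obtain ⟨c, hc, hxc, hleaf⟩ : ∃ c ∈ S, G.Adj x c ∧
      ∀ y ∈ S, G.Adj x y → G.Adj c y → codegIn G S x y = 1 := by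
    by_contra! hcon
    obtain ⟨z, hz, hxz, hyz, hz1⟩ := hcon y₀ hy₀ hxy₀
    obtain ⟨y, hy, hxy, hzy, hy1⟩ := hcon z hz hxz
    have hz2 : 2 ≤ codegIn G S x z := by
      have := codegIn_pos hy₀ hxy₀ hyz.symm
      omega
    have hy2 : 2 ≤ codegIn G S x y := by
      have := codegIn_pos hz hxz hzy.symm
      omega
    obtain ⟨s, hs, hxs, hys, hsz⟩ := exists_ne_of_codegIn hy2 z
    by_cases hyy : y = y₀
    · subst hyy
      obtain ⟨u, hu, hxu, hzu, huy⟩ := exists_ne_of_codegIn hz2 y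
      have hus : u ≠ s := by
        rintro rfl
        exact hK z hz u hu hxz hxu hyz hys hzu
      exact hG x u z y s huy hus hsz.symm hxu hxz hxy hxs hzu.symm hzy hys
    · have hsy : y₀ ≠ s := by
        rintro rfl
        exact hK y hy z hz hxy hxz hys.symm hyz hzy.symm
      exact hG x y₀ z y s (Ne.symm hyy) hsy hsz.symm hxy₀ hxz hxy hxs hyz hzy hys
  have h := link_sum_le_of_weight (G := G) (S := S) (x := x)
    (fun y => if y = c then 0 else 1 / codegIn G S x y) ?_
  · refine h.trans ?_
    have hmem : c ∈ S.filter (G.Adj x) := mem_filter.2 ⟨hc, hxc⟩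
    have hcard : (degIn G S x : ℝ) = #((S.filter (G.Adj x)).erase c) + 1 := by
      unfold degIn
      exact_mod_cast (card_erase_add_one hmem).symm
    rw [hcard, ← add_sum_erase _ _ hmem, card_eq_sum_ones, Nat.cast_sum]
    have : ∑ y ∈ (S.filter (G.Adj x)).erase c,
        (if y = c then (0 : ℝ) else 1 / codegIn G S x y) * codegIn G S x y ≤
        ∑ y ∈ (S.filter (G.Adj x)).erase c, ((1 : ℕ) : ℝ) := by
      gcongr with y hy
      rw [if_neg (mem_erase.1 hy).1, one_div_mul_eq_div]
      simpa using div_self_le_one (codegIn G S x y : ℝ)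
    simp only [if_true, zero_mul, zero_add]
    linarith
  · intro y hy z hz hxy hyz hxz
    by_cases h1 : y = c
    · have h2 : z ≠ c := by rintro rfl; exact hyz.ne h1
      subst h1
      simp [h2, hleaf z hz hxz hyz]
    · by_cases h2 : z = c
      · subst h2
        simp [h1, hleaf y hy hxy hyz.symm]
      · simpa [h1, h2] using hG.one_le_inv_add_inv hy hz hxy hyz hxz

lemma link_sum_le_choose (S : Finset V) (x : V) :
    ∑ y ∈ S, ∑ z ∈ S, tri G x y z ≤ degIn G S x * (degIn G S x - 1) := by
  have h : ∀ y ∈ S, ∑ z ∈ S, tri G x y z ≤ if G.Adj x y then (degIn G S x - 1 : ℝ) else 0 := by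
    intro y hy
    rw [sum_tri]
    split_ifs with hxy
    · have hmem : y ∈ S.filter (G.Adj x) := mem_filter.2 ⟨hy, hxy⟩
      have h1 : codegIn G S x y ≤ #((S.filter (G.Adj x)).erase y) := card_le_card fun z hz => by
        rw [mem_filter] at hz
        exact mem_erase.2 ⟨hz.2.2.ne', mem_filter.2 ⟨hz.1, hz.2.1⟩⟩
      have h2 : codegIn G S x y + 1 ≤ degIn G S x := by
        have h3 : #((S.filter (G.Adj x)).erase y) + 1 = degIn G S x := card_erase_add_one hmem
        omega
      rw [le_sub_iff_add_le]
      exact_mod_cast h2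
    · exact le_rfl
  refine (sum_le_sum h).trans_eq ?_
  rw [← sum_filter, sum_const, nsmul_eq_mul]
  rfl

lemma two_of_three {A B C P Q R X Y Z : Prop} (h1 : A ∨ C) (h2 : A ∨ B) (h3 : C ∨ B)
    (hX : A → ¬ (C ∧ B ∧ P) → X) (hY : B → ¬ (A ∧ C ∧ Q) → Y) (hZ : C → ¬ (A ∧ B ∧ R) → Z)
    (n1 : ¬ (P ∧ Q)) (n2 : ¬ (P ∧ R)) (n3 : ¬ (Q ∧ R)) : (X ∧ Y) ∨ (X ∧ Z) ∨ (Y ∧ Z) := by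
  grind

/-- Without four-cliques, choosing two suitable edges from every triangle yields a triangle-free
subgraph in which every edge is chosen by at most one triangle. -/
lemma exists_rel_of_no_four_clique [LinearOrder V] (hG : LinkP4Free G) (W : Finset V)
    (hW : ∀ a ∈ W, ∀ b ∈ W, ∀ c ∈ W, ∀ d ∈ W, G.Adj a b → G.Adj a c → G.Adj a d → G.Adj b c →
      G.Adj b d → ¬ G.Adj c d) :
    ∃ R : V → V → Prop, (∀ u v, R u v → R v u) ∧ (∀ u v, R u v → G.Adj u v) ∧
      (∀ u ∈ W, ∀ v ∈ W, ∀ z ∈ W, R u v → R v z → ¬ R u z) ∧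
      2 * triSum G W W W ≤ 3 * ∑ u ∈ W, ∑ v ∈ W, if R u v then (1 : ℝ) else 0 := by
  have hlight : ∀ x ∈ W, ∀ y ∈ W, ∀ z ∈ W, G.Adj x y → G.Adj y z → G.Adj x z →
      codegIn G W x y = 1 ∨ codegIn G W x z = 1 := by
    intro x hx y hy z hz hxy hyz hxz
    by_contra! h
    have h1 : 2 ≤ codegIn G W x y := by
      have := codegIn_pos hz hxz hyz
      omega
    have h2 : 2 ≤ codegIn G W x z := by
      have := codegIn_pos hy hxy hyz.symm
      omega
    obtain ⟨p, hp, hxp, hyp, hpz⟩ := exists_ne_of_codegIn h1 z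
    obtain ⟨s, hs, hxs, hzs, hsy⟩ := exists_ne_of_codegIn h2 y
    by_cases hps : p = s
    · subst hps
      exact hW x hx y hy z hz p hp hxy hxz hxp hyz hyp hzs
    · exact hG x p y z s hpz hps hsy.symm hxp hxy hxz hxs hyp.symm hyz hzs
  set c := codegIn G W with hc
  have hcs : ∀ x y, c x y = c y x := codegIn_comm W
  obtain ⟨R, hRdef⟩ : ∃ R : V → V → Prop, ∀ u v, R u v ↔ G.Adj u v ∧ c u v = 1 ∧
      ∀ z ∈ W, G.Adj u z → G.Adj v z → c u z = 1 → c v z = 1 → z < u → ¬ z < v :=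
    ⟨_, fun _ _ => Iff.rfl⟩
  have hadj : ∀ u v, R u v → G.Adj u v := fun u v h => ((hRdef u v).1 h).1
  have hone : ∀ u v, R u v → c u v = 1 := fun u v h => ((hRdef u v).1 h).2.1
  have hsymm : ∀ u v, R u v → R v u := by
    intro u v h
    obtain ⟨h1, h2, h3⟩ := (hRdef u v).1 h
    exact (hRdef v u).2 ⟨h1.symm, hcs u v ▸ h2, fun z hz ha hb hc hd he hf => h3 z hz hb ha hd hc hf he⟩
  have hmin : ∀ u v z, z ∈ W → R u v → R v z → R u z → z < u → ¬ z < v :=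
    fun u v z hz huv hvz huz => ((hRdef u v).1 huv).2.2 z hz (hadj _ _ huz) (hadj _ _ hvz)
      (hone _ _ huz) (hone _ _ hvz)
  refine ⟨R, hsymm, hadj, ?_, ?_⟩
  · intro u hu v hv z hz huv hvz huz
    have h1 := hmin u v z hz huv hvz huz
    have h2 := hmin v z u hu hvz (hsymm _ _ huz) (hsymm _ _ huv)
    have h3 := hmin u z v hv huz (hsymm _ _ hvz) huv
    have n1 := (hadj _ _ huv).ne
    have n2 := (hadj _ _ hvz).ne
    have n3 := (hadj _ _ huz).ne
    rcases n1.lt_or_gt with l1 | l1 <;> rcases n2.lt_or_gt with l2 | l2 <;>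
      rcases n3.lt_or_gt with l3 | l3 <;> first
      | exact h1 l3 l2
      | exact h2 l1 l3
      | exact h3 l1 l2
      | exact absurd (l1.trans l2) l3.asymm
      | exact absurd (l2.trans l1) l3.asymm
  · let r : V → V → ℝ := fun u v => if R u v then 1 else 0
    have hr : ∀ u v, R u v → r u v = 1 := fun u v h => if_pos h
    have hr0 : ∀ u v, 0 ≤ r u v := fun u v => by simp only [r]; split_ifs <;> norm_num
    have htwo : ∀ x ∈ W, ∀ y ∈ W, ∀ z ∈ W, G.Adj x y → G.Adj y z → G.Adj x z →
        2 ≤ r x y + (r y z + r x z) := by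
      intro x hx y hy z hz hxy hyz hxz
      have hR : ∀ u ∈ W, ∀ v ∈ W, ∀ t ∈ W, G.Adj u v → G.Adj v t → G.Adj u t → c u v = 1 →
          ¬ (c u t = 1 ∧ c v t = 1 ∧ t < u ∧ t < v) → R u v := by
        intro u hu v hv t ht huv hvt hut h1 hn
        refine (hRdef u v).2 ⟨huv, h1, fun t' ht' hut' hvt' e1 e2 l1 l2 => ?_⟩
        by_cases htt : t' = t
        · subst htt; exact hn ⟨e1, e2, l1, l2⟩
        · have : 1 < c u v :=
            one_lt_card.2 ⟨t', mem_filter.2 ⟨ht', hut', hvt'⟩, t, mem_filter.2 ⟨ht, hut, hvt⟩, htt⟩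
          omega
      have l1 := hlight x hx y hy z hz hxy hyz hxz
      have l2 := hlight y hy x hx z hz hxy.symm hxz hyz
      have l3 := hlight z hz x hx y hy hxz.symm hxy hyz.symm
      have a1 := hR x hx y hy z hz hxy hyz hxz
      have a2 := hR y hy z hz x hx hyz hxz.symm hxy.symm
      have a3 := hR x hx z hz y hy hxz hyz.symm hxy
      rw [hcs y x] at l2 a2
      rw [hcs z x] at l3 a2
      rw [hcs z y] at l3 a3
      have hpair : (R x y ∧ R y z) ∨ (R x y ∧ R x z) ∨ (R y z ∧ R x z) := by
        have n1 : ¬ ((z < x ∧ z < y) ∧ (x < y ∧ x < z)) := fun h => h.1.1.asymm h.2.2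
        have n2 : ¬ ((z < x ∧ z < y) ∧ (y < x ∧ y < z)) := fun h => h.1.2.asymm h.2.2
        have n3 : ¬ ((x < y ∧ x < z) ∧ (y < x ∧ y < z)) := fun h => h.1.1.asymm h.2.1
        exact two_of_three l1 l2 l3 a1 a2 a3 n1 n2 n3
      have p1 := hr0 x y
      have p2 := hr0 y z
      have p3 := hr0 x z
      rcases hpair with ⟨h, h'⟩ | ⟨h, h'⟩ | ⟨h, h'⟩ <;> rw [hr _ _ h, hr _ _ h'] <;> linarith
    have e1 : ∑ x ∈ W, ∑ y ∈ W, ∑ z ∈ W, tri G x y z * r x y = ∑ x ∈ W, ∑ y ∈ W, r x y := by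
      refine sum_congr rfl fun x _ => sum_congr rfl fun y _ => ?_
      rw [← sum_mul, sum_tri]
      by_cases h : R x y
      · have h1 : codegIn G W x y = 1 := hone x y h
        rw [if_pos (hadj x y h), h1, Nat.cast_one, one_mul]
      · simp [r, h]
    have e2 : ∑ x ∈ W, ∑ y ∈ W, ∑ z ∈ W, tri G x y z * r x z =
        ∑ x ∈ W, ∑ y ∈ W, ∑ z ∈ W, tri G x y z * r x y := by
      refine sum_congr rfl fun x _ => ?_
      rw [sum_comm]
      exact sum_congr rfl fun y _ => sum_congr rfl fun z _ => by rw [tri_comm_right]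
    have e3 : ∑ x ∈ W, ∑ y ∈ W, ∑ z ∈ W, tri G x y z * r y z =
        ∑ x ∈ W, ∑ y ∈ W, ∑ z ∈ W, tri G x y z * r x z := by
      rw [sum_comm]
      exact sum_congr rfl fun y _ => sum_congr rfl fun z _ => sum_congr rfl fun x _ => by
        rw [tri_comm_left]
    have h : triSum G W W W * 2 ≤
        ∑ x ∈ W, ∑ y ∈ W, ∑ z ∈ W, tri G x y z * (r x y + (r y z + r x z)) := by
      unfold triSum
      simp only [sum_mul]
      exact sum_le_sum fun x hx => sum_le_sum fun y hy => sum_le_sum fun z hz =>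
        tri_mul_le (htwo x hx y hy z hz)
    simp only [mul_add, sum_add_distrib] at h
    rw [e3, e2, e1] at h
    simp only [r] at h
    linarith

/-- Mantel's theorem for the restriction of a symmetric relation to `S`. -/
lemma sum_rel_le_of_triangle_free {S : Finset V} {R : V → V → Prop} (hsymm : ∀ u v, R u v → R v u)
    (hfree : ∀ u ∈ S, ∀ v ∈ S, ∀ z ∈ S, R u v → R v z → ¬ R u z) :
    ∑ u ∈ S, ∑ v ∈ S, (if R u v then (1 : ℝ) else 0) ≤ (#S : ℝ) ^ 2 / 2 := by
  set r : V → V → ℝ := fun u v => if R u v then 1 else 0 with hrdef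
  set D : V → ℝ := fun u => ∑ v ∈ S, r u v with hD
  have hrs : ∀ u v, r u v = r v u := fun u v => by
    simp only [r, show R u v ↔ R v u from ⟨hsymm u v, hsymm v u⟩]
  have hdeg : ∀ u ∈ S, ∀ v ∈ S, r u v * (D u + D v) ≤ r u v * #S := by
    intro u hu v hv
    by_cases huv : R u v
    · have : D u + D v ≤ #S := by
        simp only [hD]
        rw [← sum_add_distrib, card_eq_sum_ones, Nat.cast_sum]
        refine sum_le_sum fun z hz => ?_
        have := hfree u hu v hv z hz huv
        simp only [r]
        split_ifs with h1 h2 <;> first | exact absurd h1 (this h2) | norm_num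
      simpa [r, huv] using this
    · simp [r, huv]
  have h1 : ∑ u ∈ S, ∑ v ∈ S, r u v * D u = ∑ u ∈ S, D u ^ 2 :=
    sum_congr rfl fun u _ => by rw [← sum_mul]; simp only [hD]; ring
  have h2 : ∑ u ∈ S, ∑ v ∈ S, r u v * D v = ∑ u ∈ S, D u ^ 2 := by
    rw [sum_comm, ← h1]
    exact sum_congr rfl fun u _ => sum_congr rfl fun v _ => by rw [hrs]
  have h3 : ∑ u ∈ S, ∑ v ∈ S, r u v * (D u + D v) ≤ ∑ u ∈ S, ∑ v ∈ S, r u v * #S :=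
    sum_le_sum fun u hu => sum_le_sum fun v hv => hdeg u hu v hv
  have h4 : ∑ u ∈ S, ∑ v ∈ S, r u v * (#S : ℝ) = (∑ u ∈ S, D u) * #S := by
    rw [sum_mul]
    exact sum_congr rfl fun u _ => (sum_mul ..).symm
  simp only [mul_add, sum_add_distrib] at h3
  rw [h1, h2, h4] at h3
  have h5 := sq_sum_le_card_mul_sum_sq (s := S) (f := D)
  change ∑ u ∈ S, D u ≤ _
  set s := ∑ u ∈ S, D u
  have hs : 0 ≤ s := sum_nonneg fun u _ => sum_nonneg fun v _ => by
    simp only [r]; split_ifs <;> norm_num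
  have hm : (0 : ℝ) ≤ #S := Nat.cast_nonneg _
  rcases hs.eq_or_lt with h0 | h0
  · rw [← h0]; exact div_nonneg (sq_nonneg _) zero_le_two
  · have : s * (2 * s) ≤ s * (#S : ℝ) ^ 2 := by nlinarith
    have := le_of_mul_le_mul_left this h0
    linarith

variable [Fintype V]

/-- Triangles meeting both `U` and its complement, counted along crossing edges. -/
lemma LinkP4Free.triSum_crossing_le (hG : LinkP4Free G) (U : Finset V) :
    triSum G U Uᶜ Uᶜ + triSum G U U Uᶜ ≤ 2 * ∑ w ∈ Uᶜ, (degIn G U w : ℝ) := by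
  set c : V → V → ℝ := fun x y => 1 / codegIn G univ x y
  have hc : ∀ x y, c x y = c y x := fun x y => by simp only [c, codegIn_comm]
  have key : ∀ A B : Finset V, triSum G A B B ≤
      2 * ∑ x ∈ A, ∑ y ∈ B, ∑ z ∈ B, tri G x y z * c x y := by
    intro A B
    have h1 : triSum G A B B ≤
        ∑ x ∈ A, ∑ y ∈ B, ∑ z ∈ B, tri G x y z * (c x y + c x z) :=
      sum_le_sum fun x _ => sum_le_sum fun y _ => sum_le_sum fun z _ => tri_le_mul fun h h' h'' =>
        hG.one_le_inv_add_inv (mem_univ _) (mem_univ _) h h' h''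
    have h2 : ∑ x ∈ A, ∑ y ∈ B, ∑ z ∈ B, tri G x y z * c x z =
        ∑ x ∈ A, ∑ y ∈ B, ∑ z ∈ B, tri G x y z * c x y := by
      refine sum_congr rfl fun x _ => ?_
      rw [sum_comm]
      exact sum_congr rfl fun y _ => sum_congr rfl fun z _ => by rw [tri_comm_right]
    simp only [mul_add, sum_add_distrib] at h1
    linarith
  have h1 := key U Uᶜ
  have h2 := key Uᶜ U
  have h3 : triSum G U U Uᶜ = triSum G Uᶜ U U := by
    rw [triSum_comm_right, triSum_comm_left]
  have h4 : ∑ x ∈ U, ∑ y ∈ Uᶜ, ∑ z ∈ Uᶜ, tri G x y z * c x y =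
      ∑ y ∈ Uᶜ, ∑ x ∈ U, ∑ z ∈ Uᶜ, tri G y x z * c y x := by
    rw [sum_comm]
    exact sum_congr rfl fun y _ => sum_congr rfl fun z _ => sum_congr rfl fun x _ => by
      rw [tri_comm_left, hc]
  have h5 : ∑ y ∈ Uᶜ, ∑ x ∈ U, ∑ z ∈ Uᶜ, tri G y x z * c y x +
      ∑ y ∈ Uᶜ, ∑ x ∈ U, ∑ z ∈ U, tri G y x z * c y x ≤ ∑ w ∈ Uᶜ, (degIn G U w : ℝ) := by
    rw [← sum_add_distrib]
    refine sum_le_sum fun w _ => ?_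
    rw [← sum_add_distrib]
    have : (degIn G U w : ℝ) = ∑ x ∈ U, if G.Adj w x then 1 else 0 := by
      simp [degIn]
    rw [this]
    refine sum_le_sum fun x _ => ?_
    rw [add_comm, sum_add_sum_compl]
    exact sum_tri_div_codegIn_le univ w x
  linarith

lemma triSum_univ (U : Finset V) :
    triSum G univ univ univ = triSum G U U U + triSum G Uᶜ Uᶜ Uᶜ +
      3 * (triSum G U Uᶜ Uᶜ + triSum G U U Uᶜ) := by
  have h1 : ∀ B C, triSum G univ B C = triSum G U B C + triSum G Uᶜ B C := fun B C => by
    simp only [triSum, sum_add_sum_compl]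
  have h2 : ∀ A C, triSum G A univ C = triSum G A U C + triSum G A Uᶜ C := fun A C => by
    rw [triSum_comm_left, h1, triSum_comm_left, triSum_comm_left Uᶜ]
  have h3 : ∀ A B, triSum G A B univ = triSum G A B U + triSum G A B Uᶜ := fun A B => by
    rw [triSum_comm_right, h2, triSum_comm_right, triSum_comm_right _ Uᶜ]
  rw [h1, h2, h2, h3, h3, h3, h3, triSum_comm_right U Uᶜ U, triSum_comm_left Uᶜ U U,
    triSum_comm_right U Uᶜ U, triSum_comm_left Uᶜ U Uᶜ, triSum_comm_right Uᶜ Uᶜ U,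
    triSum_comm_left Uᶜ U Uᶜ]
  ring

end Counting

section Cliques

open Finset Classical

variable {V : Type*} {G : SimpleGraph V}

lemma LinkP4Free.degIn_four_clique_le (hG : LinkP4Free G) {Q : Finset V} (hQ : G.IsNClique 4 Q)
    {x : V} (hx : x ∉ Q) : degIn G Q x ≤ 1 := by
  by_contra! h
  obtain ⟨u, hu, v, hv, huv⟩ := one_lt_card.1 (show 1 < #{y ∈ Q | G.Adj x y} from h)
  rw [mem_filter] at hu hv
  have hc : #((Q.erase u).erase v) = 2 := by
    rw [card_erase_of_mem (mem_erase.2 ⟨huv.symm, hv.1⟩), card_erase_of_mem hu.1, hQ.card_eq]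
  obtain ⟨p, s, hps, he⟩ := card_eq_two.1 hc
  have hp : p ∈ (Q.erase u).erase v := by simp [he]
  have hs : s ∈ (Q.erase u).erase v := by simp [he]
  simp only [mem_erase] at hp hs
  have adj : ∀ {a b}, a ∈ Q → b ∈ Q → a ≠ b → G.Adj a b := fun ha hb hab => hQ.isClique ha hb hab
  exact hG u x v p s (fun h => hx (h ▸ hp.2.2)) (fun h => hx (h ▸ hs.2.2)) hs.1.symm
    hu.2.symm (adj hu.1 hv.1 huv) (adj hu.1 hp.2.2 hp.2.1.symm) (adj hu.1 hs.2.2 hs.2.1.symm)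
    hv.2 (adj hv.1 hp.2.2 hp.1.symm) (adj hp.2.2 hs.2.2 hps)

lemma LinkP4Free.eq_of_adj_four_clique (hG : LinkP4Free G) {Q : Finset V} (hQ : G.IsNClique 4 Q)
    {x u v : V} (hx : x ∉ Q) (hu : u ∈ Q) (hv : v ∈ Q) (hxu : G.Adj x u) (hxv : G.Adj x v) :
    u = v :=
  card_le_one.1 (hG.degIn_four_clique_le hQ hx) u (mem_filter.2 ⟨hu, hxu⟩) v
    (mem_filter.2 ⟨hv, hxv⟩)

lemma tri_eq_zero {x y z : V} (h : G.Adj x y → G.Adj y z → G.Adj x z → False) :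
    tri G x y z = 0 := if_neg fun h' => h h'.1 h'.2.1 h'.2.2

/-- A triangle with two vertices in a four-clique has all its vertices there. -/
lemma LinkP4Free.tri_eq_zero_of_four_clique (hG : LinkP4Free G) {Q : Finset V} (hQ : G.IsNClique 4 Q)
    {x y z : V} (hx : x ∈ Q) (hy : y ∈ Q) (hz : z ∉ Q) : tri G x y z = 0 :=
  tri_eq_zero fun hxy hyz hxz =>
    hxy.ne (hG.eq_of_adj_four_clique hQ hz hx hy hxz.symm hyz.symm)

lemma degIn_le_card_sub_one {S : Finset V} {x : V} (hx : x ∈ S) : degIn G S x ≤ #S - 1 := by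
  rw [← card_erase_of_mem hx]
  refine card_le_card fun y hy => ?_
  rw [mem_filter] at hy
  exact mem_erase.2 ⟨hy.2.ne', hy.1⟩

lemma isNClique_four {a b c d : V} (hab : G.Adj a b) (hac : G.Adj a c) (had : G.Adj a d)
    (hbc : G.Adj b c) (hbd : G.Adj b d) (hcd : G.Adj c d) : G.IsNClique 4 {a, b, c, d} :=
  (SimpleGraph.is3Clique_triple_iff.2 ⟨hbc, hbd, hcd⟩).insert (by simp [hab, hac, had])

lemma LinkP4Free.degIn_biUnion_le (hG : LinkP4Free G) {F : Finset (Finset V)}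
    (hF : ∀ Q ∈ F, G.IsNClique 4 Q) {x : V} (hx : x ∉ F.biUnion id) :
    degIn G (F.biUnion id) x ≤ #F := by
  unfold degIn
  rw [filter_biUnion]
  refine card_biUnion_le_card_mul _ _ 1 (fun Q hQ => hG.degIn_four_clique_le (hF Q hQ) ?_)
    |>.trans (mul_one _).le
  exact fun hxQ => hx (mem_biUnion.2 ⟨Q, hQ, hxQ⟩)

lemma card_biUnion_four_cliques {F : Finset (Finset V)} (hF : ∀ Q ∈ F, G.IsNClique 4 Q)
    (hd : (F : Set (Finset V)).PairwiseDisjoint id) : #(F.biUnion id) = 4 * #F := by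
  rw [card_biUnion hd, mul_comm]
  exact sum_const_nat fun Q hQ => (hF Q hQ).card_eq

lemma link_four_clique_le {Q : Finset V} (hQ : G.IsNClique 4 Q) {x : V} (hx : x ∈ Q) :
    ∑ y ∈ Q, ∑ z ∈ Q, tri G x y z ≤ 6 := by
  have h1 : degIn G Q x ≤ 3 := by
    have := degIn_le_card_sub_one (G := G) hx
    rwa [hQ.card_eq] at this
  have h2 := link_sum_le_choose (G := G) Q x
  have h3 : (degIn G Q x : ℝ) ≤ 3 := by exact_mod_cast h1
  have h4 : (0 : ℝ) ≤ degIn G Q x := Nat.cast_nonneg _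
  nlinarith

lemma triSum_four_clique_le {Q : Finset V} (hQ : G.IsNClique 4 Q) : triSum G Q Q Q ≤ 24 := by
  refine (sum_le_card_nsmul _ _ 6 fun x hx => link_four_clique_le hQ hx).trans ?_
  rw [hQ.card_eq]; norm_num

lemma LinkP4Free.link_biUnion_le (hG : LinkP4Free G) {F : Finset (Finset V)}
    (hF : ∀ Q ∈ F, G.IsNClique 4 Q) (hd : (F : Set (Finset V)).PairwiseDisjoint id) {x : V}
    (hx : x ∈ F.biUnion id) :
    ∑ y ∈ F.biUnion id, ∑ z ∈ F.biUnion id, tri G x y z ≤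
      6 + min ((#F - 1 : ℝ) * (#F - 2)) (2 * (#F - 1)) := by
  obtain ⟨Q, hQ, hxQ⟩ := mem_biUnion.1 hx
  set S := (F.erase Q).biUnion id with hS
  have hUS : F.biUnion id = Q ∪ S := by
    rw [hS, ← insert_erase hQ, biUnion_insert, erase_insert (notMem_erase _ _)]
    rfl
  have hQS : Disjoint Q S := by
    rw [hS, disjoint_biUnion_right]
    exact fun Q' hQ' => (hd hQ (mem_erase.1 hQ').2 (mem_erase.1 hQ').1.symm)
  have hsplit : ∑ y ∈ F.biUnion id, ∑ z ∈ F.biUnion id, tri G x y z =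
      ∑ y ∈ Q, ∑ z ∈ Q, tri G x y z + ∑ y ∈ S, ∑ z ∈ S, tri G x y z := by
    rw [hUS, sum_union hQS]
    congr 1
    · refine sum_congr rfl fun y hy => ?_
      rw [sum_union hQS, add_eq_left]
      exact sum_eq_zero fun z hz => hG.tri_eq_zero_of_four_clique (hF Q hQ) hxQ hy (disjoint_right.1 hQS hz)
    · refine sum_congr rfl fun y hy => ?_
      rw [sum_union hQS, add_eq_right]
      exact sum_eq_zero fun z hz => by
        rw [tri_comm_right]
        exact hG.tri_eq_zero_of_four_clique (hF Q hQ) hxQ hz (disjoint_right.1 hQS hy)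
  have hdeg : (degIn G S x : ℝ) ≤ #F - 1 := by
    have h1 := hG.degIn_biUnion_le (F := F.erase Q) (fun Q' hQ' => hF Q' (mem_of_mem_erase hQ'))
      (disjoint_left.1 hQS hxQ)
    have h2 := card_erase_add_one hQ
    rw [le_sub_iff_add_le]
    exact_mod_cast (Nat.add_le_add_right h1 1).trans h2.le
  have h1 := link_sum_le_choose (G := G) S x
  have h2 := hG.link_sum_le S x
  have h0 := link_four_clique_le (hF Q hQ) hxQ
  rw [hsplit]
  refine add_le_add h0 (le_min ?_ (by linarith))
  rcases Nat.eq_zero_or_pos (degIn G S x) with hz | hz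
  · rw [hz] at h1
    have hj : #F ≠ 0 := (card_pos.2 ⟨Q, hQ⟩).ne'
    have : (0 : ℝ) ≤ (#F - 1) * (#F - 2) := by
      rcases (show #F = 1 ∨ 2 ≤ #F by omega) with h | h
      · simp [h]
      · have : (2 : ℝ) ≤ #F := by exact_mod_cast h
        nlinarith
    simp only [Nat.cast_zero, zero_mul] at h1
    linarith
  · have : (1 : ℝ) ≤ degIn G S x := by exact_mod_cast hz
    nlinarith

lemma LinkP4Free.exists_rel (hG : LinkP4Free G) {W : Finset V}
    (hW : ∀ Q ⊆ W, ¬ G.IsNClique 4 Q) :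
    ∃ R : V → V → Prop, (∀ u v, R u v → R v u) ∧ (∀ u v, R u v → G.Adj u v) ∧
      (∀ u ∈ W, ∀ v ∈ W, ∀ z ∈ W, R u v → R v z → ¬ R u z) ∧
      2 * triSum G W W W ≤ 3 * ∑ u ∈ W, ∑ v ∈ W, if R u v then (1 : ℝ) else 0 := by
  have hW' : ∀ a ∈ W, ∀ b ∈ W, ∀ c ∈ W, ∀ d ∈ W, G.Adj a b → G.Adj a c → G.Adj a d → G.Adj b c →
      G.Adj b d → ¬ G.Adj c d := fun a ha b hb c hc d hd h1 h2 h3 h4 h5 h6 => hW {a, b, c, d}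
    (by simp [insert_subset_iff, ha, hb, hc, hd]) (isNClique_four h1 h2 h3 h4 h5 h6)
  let _ : LinearOrder V := linearOrderOfSTO WellOrderingRel
  exact exists_rel_of_no_four_clique hG W hW'

lemma LinkP4Free.triSum_le_of_no_four_clique (hG : LinkP4Free G) {W : Finset V}
    (hW : ∀ Q ⊆ W, ¬ G.IsNClique 4 Q) : triSum G W W W ≤ 3 / 4 * (#W : ℝ) ^ 2 := by
  obtain ⟨R, hs, -, hf, h⟩ := hG.exists_rel hW
  have := sum_rel_le_of_triangle_free hs hf
  linarith

variable [Fintype V]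

/-- A largest family of pairwise disjoint four-cliques. -/
lemma exists_max_family (G : SimpleGraph V) : ∃ F : Finset (Finset V),
    (∀ Q ∈ F, G.IsNClique 4 Q) ∧ (F : Set (Finset V)).PairwiseDisjoint id ∧
    ∀ F' : Finset (Finset V), (∀ Q ∈ F', G.IsNClique 4 Q) →
      (F' : Set (Finset V)).PairwiseDisjoint id → #F' ≤ #F := by
  obtain ⟨F, hF, hmax⟩ := exists_max_image
    {F : Finset (Finset V) | (∀ Q ∈ F, G.IsNClique 4 Q) ∧
      (F : Set (Finset V)).PairwiseDisjoint id} card ⟨∅, by simp⟩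
  simp only [mem_filter, mem_univ, true_and] at hF hmax
  exact ⟨F, hF.1, hF.2, fun F' h h' => hmax F' ⟨h, h'⟩⟩

end Cliques

section Upper

open Finset Classical

variable {V : Type*} {G : SimpleGraph V}

lemma LinkP4Free.sum_link_le_sub (hG : LinkP4Free G) {Q W : Finset V} {q y : V} (hq : q ∈ Q)
    (hy : y ∈ W) (hqy : G.Adj q y)
    (hK : ∀ u ∈ W, ∀ v ∈ W, G.Adj q u → G.Adj q v → G.Adj y u → G.Adj y v → ¬ G.Adj u v) :
    triSum G Q W W ≤ 2 * ∑ q ∈ Q, (degIn G W q : ℝ) - 2 := by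
  have h : ∀ p ∈ Q, ∑ y ∈ W, ∑ z ∈ W, tri G p y z ≤
      2 * (degIn G W p : ℝ) - if p = q then 2 else 0 := by
    intro p _
    split_ifs with hp
    · subst hp
      exact hG.link_sum_le_sub hy hqy hK
    · linarith [hG.link_sum_le W p]
  refine (sum_le_sum h).trans_eq ?_
  rw [sum_sub_distrib, ← mul_sum, sum_ite_eq' Q q, if_pos hq]

lemma LinkP4Free.sum_link_le (hG : LinkP4Free G) (Q W : Finset V) :
    triSum G Q W W ≤ 2 * ∑ q ∈ Q, (degIn G W q : ℝ) := by
  rw [mul_sum]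
  exact sum_le_sum fun p _ => hG.link_sum_le W p

lemma sum_degIn_comm (Q W : Finset V) :
    ∑ q ∈ Q, (degIn G W q : ℝ) = ∑ w ∈ W, (degIn G Q w : ℝ) := by
  have h : ∀ (S : Finset V) (x : V), (degIn G S x : ℝ) = ∑ y ∈ S, if G.Adj x y then 1 else 0 :=
    fun S x => by simp [degIn]
  simp only [h]
  rw [sum_comm]
  simp only [G.adj_comm]

/-- Improved bound on the triangles outside `Q` when a triangle outside `Q` extends to a
four-clique by a vertex of `Q`. -/
lemma LinkP4Free.triSum_le_of_mixed (hG : LinkP4Free G) {W : Finset V}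
    (hfree : ∀ K ⊆ W, ¬ G.IsNClique 4 K) {q x y z : V} (hq : q ∉ W) (hx : x ∈ W) (hy : y ∈ W)
    (hz : z ∈ W) (hK : G.IsNClique 4 {q, x, y, z}) (hxy : x ≠ y) (hxz : x ≠ z) (hyz : y ≠ z) :
    triSum G W W W ≤ 3 / 2 * (4 + 2 * (#W - 3) + (#W - 3 : ℝ) ^ 2 / 2) := by
  obtain ⟨R, hs, hadj, hf, h⟩ := hG.exists_rel hfree
  set r : V → V → ℝ := fun u v => if R u v then 1 else 0 with hr
  have hrs : ∀ u v, r u v = r v u := fun u v => by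
    simp only [r, show R u v ↔ R v u from ⟨hs u v, hs v u⟩]
  have hr1 : ∀ u v, r u v ≤ 1 := fun u v => by simp only [r]; split_ifs <;> norm_num
  have hrr : ∀ u, r u u = 0 := fun u => if_neg fun h => (hadj u u h).ne rfl
  set T : Finset V := {x, y, z} with hT
  have hTW : T ⊆ W := by simp [hT, insert_subset_iff, hx, hy, hz]
  have hcT : #T = 3 := card_eq_three.2 ⟨x, y, z, hxy, hxz, hyz, rfl⟩
  have hcard : (#(W \ T) : ℝ) = #W - 3 := by
    rw [card_sdiff_of_subset hTW, hcT, Nat.cast_sub (hcT ▸ card_le_card hTW)]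
    norm_num
  have hsplit : ∑ u ∈ W, ∑ v ∈ W, r u v = ∑ u ∈ W \ T, ∑ v ∈ W \ T, r u v +
      2 * ∑ u ∈ W \ T, ∑ v ∈ T, r u v + ∑ u ∈ T, ∑ v ∈ T, r u v := by
    have hc : ∑ u ∈ T, ∑ v ∈ W \ T, r u v = ∑ u ∈ W \ T, ∑ v ∈ T, r u v := by
      rw [sum_comm]; simp only [hrs]
    rw [← sum_sdiff hTW]
    simp only [← sum_sdiff hTW (f := r _), sum_add_distrib]
    rw [hc]; ring
  have h1 : ∑ u ∈ W \ T, ∑ v ∈ W \ T, r u v ≤ (#W - 3 : ℝ) ^ 2 / 2 := by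
    rw [← hcard]
    exact sum_rel_le_of_triangle_free hs fun u hu v hv t ht =>
      hf u (mem_sdiff.1 hu).1 v (mem_sdiff.1 hv).1 t (mem_sdiff.1 ht).1
  have h2 : ∑ u ∈ W \ T, ∑ v ∈ T, r u v ≤ #W - 3 := by
    rw [← hcard, card_eq_sum_ones, Nat.cast_sum]
    refine sum_le_sum fun u hu => ?_
    rw [mem_sdiff] at hu
    have huK : u ∉ ({q, x, y, z} : Finset V) := by
      rw [mem_insert, not_or]
      exact ⟨fun h => hq (h ▸ hu.1), hu.2⟩
    have hd := hG.degIn_four_clique_le hK huK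
    refine le_trans ?_ (Nat.cast_le.2 hd)
    simp only [r, sum_boole, degIn]
    exact_mod_cast card_le_card fun v hv => by
      rw [mem_filter] at hv ⊢
      exact ⟨mem_insert_of_mem hv.1, hadj u v hv.2⟩
  have h3 : ∑ u ∈ T, ∑ v ∈ T, r u v ≤ 4 := by
    have h3' : r x y + r y z + r x z ≤ 2 := by
      have := hf x hx y hy z hz
      by_cases hxy' : R x y
      · by_cases hyz' : R y z
        · have : r x z = 0 := if_neg (this hxy' hyz')
          linarith [hr1 x y, hr1 y z]
        · have : r y z = 0 := if_neg hyz'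
          linarith [hr1 x y, hr1 x z]
      · have : r x y = 0 := if_neg hxy'
        linarith [hr1 y z, hr1 x z]
    have hs3 : ∀ f : V → ℝ, ∑ v ∈ T, f v = f x + (f y + f z) := fun f => by
      rw [hT, sum_insert (by simp [hxy, hxz]), sum_insert (by simp [hyz]), sum_singleton]
    simp only [hs3, hrr]
    linarith [hrs x y, hrs y z, hrs x z]
  change 2 * triSum G W W W ≤ 3 * ∑ u ∈ W, ∑ v ∈ W, r u v at h
  linarith

variable [Fintype V]

lemma card_le_triSum (G : SimpleGraph V) :
    (6 * (G.cliqueSet 3).ncard : ℝ) ≤ triSum G univ univ univ := by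
  set T : Finset (V × V × V) := {p | G.Adj p.1 p.2.1 ∧ G.Adj p.2.1 p.2.2 ∧ G.Adj p.1 p.2.2}
  have hT : triSum G univ univ univ = #T := by
    simp only [T]
    rw [← sum_boole, ← univ_product_univ, sum_product]
    simp only [← univ_product_univ (α := V) (β := V), sum_product]
    rfl
  have hS : (G.cliqueSet 3).ncard = #(G.cliqueFinset 3) := by
    rw [← Set.ncard_coe_finset, SimpleGraph.coe_cliqueFinset]
  rw [hT, hS]
  have hmaps : ∀ p ∈ T, ({p.1, p.2.1, p.2.2} : Finset V) ∈ G.cliqueFinset 3 := by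
    intro p hp
    obtain ⟨-, h1, h2, h3⟩ := mem_filter.1 hp
    rw [SimpleGraph.mem_cliqueFinset_iff, SimpleGraph.is3Clique_triple_iff]
    exact ⟨h1, h3, h2⟩
  have hfiber : ∀ s ∈ G.cliqueFinset 3,
      6 ≤ #{p ∈ T | ({p.1, p.2.1, p.2.2} : Finset V) = s} := by
    intro s hs
    rw [SimpleGraph.mem_cliqueFinset_iff, SimpleGraph.is3Clique_iff] at hs
    obtain ⟨a, b, c, hab, hac, hbc, rfl⟩ := hs
    have hsub : ({(a, b, c), (a, c, b), (b, a, c), (b, c, a), (c, a, b), (c, b, a)} :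
        Finset (V × V × V)) ⊆ {p ∈ T | ({p.1, p.2.1, p.2.2} : Finset V) = {a, b, c}} := by
      intro p hp
      simp only [mem_insert, mem_singleton] at hp
      rcases hp with rfl | rfl | rfl | rfl | rfl | rfl <;>
        simp only [T, mem_filter, mem_univ, true_and, hab, hac, hbc, hab.symm, hac.symm,
          hbc.symm] <;> ext x <;> simp only [mem_insert, mem_singleton] <;> tauto
    refine le_trans (le_of_eq ?_) (card_le_card hsub)
    have := hab.ne
    have := hac.ne
    have := hbc.ne
    have := hab.ne'
    have := hac.ne'
    have := hbc.ne'
    rw [card_insert_of_notMem, card_insert_of_notMem, card_insert_of_notMem,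
      card_insert_of_notMem, card_insert_of_notMem, card_singleton] <;> simp [*]
  have := card_nsmul_le_sum _ _ 6 hfiber
  rw [← card_eq_sum_card_fiberwise hmaps, smul_eq_mul, mul_comm] at this
  exact_mod_cast this

lemma LinkP4Free.sum_degIn_le (hG : LinkP4Free G) {Q : Finset V} (hQ : G.IsNClique 4 Q) :
    ∑ q ∈ Q, (degIn G Qᶜ q : ℝ) ≤ #Qᶜ := by
  rw [sum_degIn_comm, card_eq_sum_ones, Nat.cast_sum]
  exact sum_le_sum fun w hw => by exact_mod_cast hG.degIn_four_clique_le hQ (mem_compl.1 hw)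

lemma LinkP4Free.sum_degIn_le_sub (hG : LinkP4Free G) {Q : Finset V} (hQ : G.IsNClique 4 Q)
    {w : V} (hw : w ∈ Qᶜ) (hn : ∀ q ∈ Q, ¬ G.Adj q w) :
    ∑ q ∈ Q, (degIn G Qᶜ q : ℝ) ≤ #Qᶜ - 1 := by
  rw [sum_degIn_comm]
  have h : ∀ v ∈ Qᶜ, (degIn G Q v : ℝ) ≤ 1 - if v = w then 1 else 0 := by
    intro v hv
    split_ifs with hvw
    · subst hvw
      have : degIn G Q v = 0 := card_eq_zero.2 (filter_eq_empty_iff.2 fun q hq h => hn q hq h.symm)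
      simp [this]
    · rw [sub_zero]
      exact_mod_cast hG.degIn_four_clique_le hQ (mem_compl.1 hv)
  refine (sum_le_sum h).trans_eq ?_
  rw [sum_sub_distrib, sum_ite_eq' Qᶜ w, if_pos hw]
  simp

lemma LinkP4Free.triSum_univ_four_clique (hG : LinkP4Free G) {Q : Finset V}
    (hQ : G.IsNClique 4 Q) : triSum G univ univ univ ≤
      24 + triSum G Qᶜ Qᶜ Qᶜ + 3 * triSum G Q Qᶜ Qᶜ := by
  have h0 : triSum G Q Q Qᶜ = 0 := sum_eq_zero fun x hx => sum_eq_zero fun y hy =>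
    sum_eq_zero fun z hz => hG.tri_eq_zero_of_four_clique hQ hx hy (mem_compl.1 hz)
  have h1 := triSum_four_clique_le hQ
  rw [triSum_univ Q]
  linarith

/-- Upper bound when no triangle of the complement of `Q` extends to a four-clique by `Q`. -/
lemma LinkP4Free.triSum_le_of_no_mixed (hG : LinkP4Free G) {Q : Finset V} (hQ : G.IsNClique 4 Q)
    (hm : 4 ≤ #Qᶜ) (hW : triSum G Qᶜ Qᶜ Qᶜ ≤ 3 / 4 * (#Qᶜ : ℝ) ^ 2)
    (hB : ∀ q ∈ Q, ∀ x ∈ Qᶜ, ∀ y ∈ Qᶜ, ∀ z ∈ Qᶜ, G.Adj q x → G.Adj q y → G.Adj q z →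
      G.Adj x y → G.Adj x z → ¬ G.Adj y z) :
    triSum G univ univ univ ≤ 3 / 4 * (#Qᶜ + 4 : ℝ) ^ 2 := by
  have htot := hG.triSum_univ_four_clique hQ
  have hE := hG.sum_link_le Q Qᶜ
  have ha := hG.sum_degIn_le hQ
  have hm' : (4 : ℝ) ≤ #Qᶜ := by exact_mod_cast hm
  have hsub : ∀ q ∈ Q, ∀ y ∈ Qᶜ, G.Adj q y →
      triSum G Q Qᶜ Qᶜ ≤ 2 * ∑ q ∈ Q, (degIn G Qᶜ q : ℝ) - 2 := fun q hq y hy hqy =>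
    hG.sum_link_le_sub hq hy hqy fun u hu v hv h1 h2 h3 h4 =>
      hB q hq y hy u hu v hv hqy h1 h2 h3 h4
  by_cases hall : ∃ q ∈ Q, ∀ w ∈ Qᶜ, G.Adj q w
  · obtain ⟨q, hq, h⟩ := hall
    have h0 : triSum G Qᶜ Qᶜ Qᶜ = 0 := sum_eq_zero fun x hx => sum_eq_zero fun y hy =>
      sum_eq_zero fun z hz => tri_eq_zero fun h1 h2 h3 =>
        hB q hq x hx y hy z hz (h x hx) (h y hy) (h z hz) h1 h3 h2
    nlinarith
  push Not at hall
  suffices triSum G Q Qᶜ Qᶜ ≤ 2 * #Qᶜ - 4 by nlinarith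
  by_cases hcov : ∀ w ∈ Qᶜ, ∃ q ∈ Q, G.Adj q w
  · obtain ⟨w₁, hw₁⟩ := card_pos.1 (show 0 < #Qᶜ by omega)
    obtain ⟨q₁, hq₁, h₁⟩ := hcov w₁ hw₁
    obtain ⟨w₂, hw₂, h₁₂⟩ := hall q₁ hq₁
    obtain ⟨q₂, hq₂, h₂⟩ := hcov w₂ hw₂
    have hne : q₁ ≠ q₂ := fun h => h₁₂ (h ▸ h₂)
    have h : ∀ p ∈ Q, ∑ y ∈ Qᶜ, ∑ z ∈ Qᶜ, tri G p y z ≤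
        2 * (degIn G Qᶜ p : ℝ) - ((if p = q₁ then 2 else 0) + if p = q₂ then 2 else 0) := by
      have hs : ∀ q ∈ Q, ∀ w ∈ Qᶜ, G.Adj q w → ∑ y ∈ Qᶜ, ∑ z ∈ Qᶜ, tri G q y z ≤
          2 * (degIn G Qᶜ q : ℝ) - 2 := fun q hq w hw hqw =>
        hG.link_sum_le_sub hw hqw fun u hu v hv h1 h2 h3 h4 =>
          hB q hq w hw u hu v hv hqw h1 h2 h3 h4
      intro p _
      by_cases hp : p = q₁
      · subst hp
        rw [if_pos rfl, if_neg hne]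
        linarith [hs p hq₁ w₁ hw₁ h₁]
      by_cases hp' : p = q₂
      · subst hp'
        rw [if_pos rfl, if_neg hp]
        linarith [hs p hq₂ w₂ hw₂ h₂]
      · rw [if_neg hp, if_neg hp']
        linarith [hG.link_sum_le Qᶜ p]
    refine (sum_le_sum h).trans ?_
    rw [sum_sub_distrib, ← mul_sum, sum_add_distrib, sum_ite_eq' Q q₁, if_pos hq₁,
      sum_ite_eq' Q q₂, if_pos hq₂]
    linarith
  · push Not at hcov
    obtain ⟨w, hw, hn⟩ := hcov
    have ha' := hG.sum_degIn_le_sub hQ hw hn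
    by_cases hex : ∃ q ∈ Q, ∃ y ∈ Qᶜ, G.Adj q y
    · obtain ⟨q, hq, y, hy, hqy⟩ := hex
      linarith [hsub q hq y hy hqy]
    · push Not at hex
      have h0 : triSum G Q Qᶜ Qᶜ = 0 := sum_eq_zero fun x hx => sum_eq_zero fun y hy =>
        sum_eq_zero fun z hz => tri_eq_zero fun h1 _ _ => hex x hx y hy h1
      linarith

end Upper

section Main

open Finset Classical

variable {V : Type*} {G : SimpleGraph V}

lemma eight_mul_sq_aux {t m : ℕ} (hm : 4 ≤ m) (h : 8 * t ≤ m ^ 2 + 6 * m + 29) :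
    8 * t ≤ (m + 4) ^ 2 := by
  by_cases h7 : 7 ≤ m
  · nlinarith
  · interval_cases m <;> omega

/-- Upper bound when every vertex outside `Q` lies in a four-clique through one fixed vertex
of `Q`. -/
lemma LinkP4Free.triSum_le_of_book (hG : LinkP4Free G) {W : Finset V} {q : V} (hq : q ∉ W)
    (hm : 4 ≤ #W) (hadj : ∀ w ∈ W, G.Adj q w)
    (hcl : ∀ w ∈ W, ∃ y ∈ W, ∃ z ∈ W, G.IsNClique 4 {q, w, y, z}) :
    triSum G W W W ≤ 2 * #W ∧ 6 ≤ #W := by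
  have hnb : ∀ w ∈ W, ∀ y z, G.IsNClique 4 {q, w, y, z} → ∀ u ∈ W, u ∉ ({w, y, z} : Finset V) →
      ∀ v ∈ ({w, y, z} : Finset V), v ∈ W → ¬ G.Adj u v := by
    intro w hw y z hK u hu hun v hv hvW huv
    have huK : u ∉ ({q, w, y, z} : Finset V) := by
      rw [mem_insert, not_or]
      exact ⟨fun h => hq (h ▸ hu), hun⟩
    have := hG.eq_of_adj_four_clique hK huK (mem_insert_self _ _) (mem_insert_of_mem hv)
      (hadj u hu).symm huv
    exact hq (this ▸ hvW)
  have hcard : ∀ {w y z : V}, G.IsNClique 4 {q, w, y, z} → #({w, y, z} : Finset V) = 3 := by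
    intro w y z hK
    have h1 := hK.card_eq
    have h2 := card_insert_le q ({w, y, z} : Finset V)
    have h3 := card_le_three (a := w) (b := y) (c := z)
    omega
  constructor
  · have hw : ∀ w ∈ W, ∑ y ∈ W, ∑ z ∈ W, tri G w y z ≤ 2 := by
      intro w hw
      obtain ⟨y, hy, z, hz, hK⟩ := hcl w hw
      have hd : degIn G W w ≤ 2 := by
        refine (card_le_card (t := {y, z}) fun u hu => ?_).trans card_le_two
        rw [mem_filter] at hu
        by_contra hn
        refine hnb w hw y z hK u hu.1 ?_ w (mem_insert_self _ _) hw hu.2.symm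
        rw [mem_insert, not_or]
        exact ⟨hu.2.ne', hn⟩
      have h1 := link_sum_le_choose (G := G) W w
      have h2 : (degIn G W w : ℝ) ≤ 2 := by exact_mod_cast hd
      have h3 : (0 : ℝ) ≤ degIn G W w := Nat.cast_nonneg _
      nlinarith
    refine (sum_le_card_nsmul _ _ 2 hw).trans_eq ?_
    rw [nsmul_eq_mul, mul_comm]
  · obtain ⟨w, hw⟩ := card_pos.1 (show 0 < #W by omega)
    obtain ⟨y, hy, z, hz, hK⟩ := hcl w hw
    obtain ⟨u, hu, hun⟩ := exists_mem_notMem_of_card_lt_card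
      (show #({w, y, z} : Finset V) < #W by rw [hcard hK]; omega)
    obtain ⟨y', hy', z', hz', hK'⟩ := hcl u hu
    have hdisj : Disjoint ({w, y, z} : Finset V) {u, y', z'} := by
      rw [disjoint_left]
      intro v hv hv'
      have hvW : v ∈ W := by
        simp only [mem_insert, mem_singleton] at hv
        rcases hv with rfl | rfl | rfl <;> assumption
      refine hnb w hw y z hK u hu hun v hv hvW (hK'.isClique (by simp) (by
        exact mem_coe.2 (mem_insert_of_mem hv')) ?_)
      rintro rfl
      exact hun hv
    have h6 := card_union_of_disjoint hdisj
    rw [hcard hK, hcard hK'] at h6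
    change 3 + 3 ≤ #W
    rw [← h6]
    refine card_le_card (union_subset ?_ ?_) <;> simp [insert_subset_iff, *]

variable [Fintype V]

/-- Upper bound when there are four-cliques, but no two disjoint ones. -/
lemma LinkP4Free.eight_mul_le_of_intersecting (hG : LinkP4Free G) {Q : Finset V}
    (hQ : G.IsNClique 4 Q) (hm : 4 ≤ #Qᶜ)
    (hint : ∀ K K', G.IsNClique 4 K → G.IsNClique 4 K' → ¬ Disjoint K K') {t : ℕ}
    (ht : (6 * t : ℝ) ≤ triSum G univ univ univ) : 8 * t ≤ (#Qᶜ + 4) ^ 2 := by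
  have hfree : ∀ K ⊆ Qᶜ, ¬ G.IsNClique 4 K := fun K hK hK4 =>
    hint K Q hK4 hQ (disjoint_left.2 fun _ h => mem_compl.1 (hK h))
  have htot := hG.triSum_univ_four_clique hQ
  have hE := hG.sum_link_le Q Qᶜ
  have ha := hG.sum_degIn_le hQ
  by_cases hB : ∀ q ∈ Q, ∀ x ∈ Qᶜ, ∀ y ∈ Qᶜ, ∀ z ∈ Qᶜ, G.Adj q x → G.Adj q y → G.Adj q z →
      G.Adj x y → G.Adj x z → ¬ G.Adj y z
  · have h := hG.triSum_le_of_no_mixed hQ hm (hG.triSum_le_of_no_four_clique hfree) hB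
    have : (8 * t : ℝ) ≤ (#Qᶜ + 4 : ℝ) ^ 2 := by linarith
    exact_mod_cast this
  push Not at hB
  obtain ⟨q, hq, x, hx, y, hy, z, hz, hqx, hqy, hqz, hxy, hxz, hyz⟩ := hB
  have hK := isNClique_four hqx hqy hqz hxy hxz hyz
  by_cases hT : triSum G Q Qᶜ Qᶜ ≤ 2 * #Qᶜ - 2
  · have h := hG.triSum_le_of_mixed hfree (fun h => mem_compl.1 h hq) hx hy hz hK hxy.ne hxz.ne
      hyz.ne
    refine eight_mul_sq_aux hm ?_
    have : (8 * t : ℝ) ≤ (#Qᶜ : ℝ) ^ 2 + 6 * #Qᶜ + 29 := by nlinarith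
    exact_mod_cast this
  have hmem : ∀ {p a b c s : V}, a ∈ Qᶜ → b ∈ Qᶜ → c ∈ Qᶜ → G.Adj p a → G.Adj p b → G.Adj p c →
      s ∈ ({p, a, b, c} : Finset V) → s = p ∨ s ∈ Qᶜ ∧ G.Adj p s := by
    intro p a b c s ha hb hc hpa hpb hpc hs
    simp only [mem_insert, mem_singleton] at hs
    rcases hs with rfl | rfl | rfl | rfl <;> simp only [true_or, or_true, and_self, *]
  have hcl : ∀ w ∈ Qᶜ, G.Adj q w ∧ ∃ y ∈ Qᶜ, ∃ z ∈ Qᶜ, G.IsNClique 4 {q, w, y, z} := by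
    intro w hw
    obtain ⟨p, hp, hpw⟩ : ∃ p ∈ Q, G.Adj p w := by
      by_contra! hn
      linarith [hG.sum_degIn_le_sub hQ hw hn]
    obtain ⟨u, hu, v, hv, hpu, hpv, hwu, hwv, huv⟩ : ∃ u ∈ Qᶜ, ∃ v ∈ Qᶜ, G.Adj p u ∧ G.Adj p v ∧
        G.Adj w u ∧ G.Adj w v ∧ G.Adj u v := by
      by_contra! hn
      linarith [hG.sum_link_le_sub hp hw hpw hn]
    have hK' := isNClique_four hpw hpu hpv hwu hwv huv
    have hpq : p = q := by
      by_contra hne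
      refine hint _ _ hK hK' (disjoint_left.2 fun s hs hs' => ?_)
      rcases hmem hw hu hv hpw hpu hpv hs' with rfl | ⟨hsQ, hps⟩ <;>
        rcases hmem hx hy hz hqx hqy hqz hs with rfl | ⟨hsQ', hqs⟩
      · exact hne rfl
      · exact mem_compl.1 hsQ' hp
      · exact mem_compl.1 hsQ hq
      · exact hne (hG.eq_of_adj_four_clique hQ (mem_compl.1 hsQ) hp hq hps.symm hqs.symm)
    subst hpq
    exact ⟨hpw, u, hu, v, hv, hK'⟩
  obtain ⟨h1, h2⟩ := hG.triSum_le_of_book (fun h => mem_compl.1 h hq) hm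
    (fun w hw => (hcl w hw).1) fun w hw => (hcl w hw).2
  have h3 : (6 : ℝ) ≤ #Qᶜ := by exact_mod_cast h2
  have : (8 * t : ℝ) ≤ (#Qᶜ + 4 : ℝ) ^ 2 := by nlinarith
  exact_mod_cast this

lemma LinkP4Free.eight_mul_ncard_le (hG : LinkP4Free G) (hn : 8 ≤ Fintype.card V) :
    8 * (G.cliqueSet 3).ncard ≤ Fintype.card V ^ 2 := by
  have ht := card_le_triSum G
  obtain ⟨F, hF, hd, hmax⟩ := exists_max_family G
  have hU := card_biUnion_four_cliques hF hd
  have hUc := card_add_card_compl (F.biUnion id)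
  rcases (show #F = 1 ∨ #F ≠ 1 by omega) with h1 | h1
  · obtain ⟨Q, rfl⟩ := card_eq_one.1 h1
    have hQ := hF Q (mem_singleton_self _)
    have hc := card_add_card_compl Q
    rw [hQ.card_eq] at hc
    rw [← hc, add_comm 4]
    refine hG.eight_mul_le_of_intersecting hQ (by omega) (fun K K' hK hK' hdis => ?_) ht
    have hne : K ≠ K' := by
      rintro rfl
      rw [disjoint_self_iff_empty] at hdis
      simpa [hdis] using hK.card_eq
    have := hmax {K, K'} (by simp [hK, hK']) (by
      rw [coe_pair]
      exact (Set.pairwiseDisjoint_singleton K' id).insert fun _ h _ => h ▸ hdis)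
    rw [card_pair hne] at this
    omega
  set U := F.biUnion id
  have hfree : ∀ K ⊆ Uᶜ, ¬ G.IsNClique 4 K := by
    intro K hK hK4
    have hdis : ∀ Q ∈ F, Disjoint K Q := fun Q hQ => disjoint_left.2 fun v hv hvQ =>
      mem_compl.1 (hK hv) (mem_biUnion.2 ⟨Q, hQ, hvQ⟩)
    have hKF : K ∉ F := fun h => by
      have := hdis K h
      rw [disjoint_self_iff_empty] at this
      simpa [this] using hK4.card_eq
    have := hmax (insert K F) (fun Q hQ => by
      rcases mem_insert.1 hQ with rfl | h
      · exact hK4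
      · exact hF Q h) (by
      rw [coe_insert]
      exact hd.insert fun Q hQ _ => hdis Q hQ)
    rw [card_insert_of_notMem hKF] at this
    omega
  have e1 := hG.triSum_le_of_no_four_clique hfree
  have e2 := hG.triSum_crossing_le U
  have e3 : ∑ w ∈ Uᶜ, (degIn G U w : ℝ) ≤ #Uᶜ * #F := by
    rw [← nsmul_eq_mul]
    exact sum_le_card_nsmul _ _ _ fun w hw => by
      exact_mod_cast hG.degIn_biUnion_le hF (mem_compl.1 hw)
  have e4 : triSum G U U U ≤ #U * (6 + min ((#F - 1 : ℝ) * (#F - 2)) (2 * (#F - 1))) := by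
    rw [← nsmul_eq_mul]
    exact sum_le_card_nsmul _ _ _ fun x hx => hG.link_biUnion_le hF hd hx
  rw [triSum_univ U] at ht
  rw [hU] at hUc e4
  rw [← hUc]
  generalize #F = j at *
  generalize #Uᶜ = m at *
  generalize (G.cliqueSet 3).ncard = t at *
  push_cast at e4
  suffices (8 * t : ℝ) ≤ (4 * j + m) ^ 2 by exact_mod_cast this
  have hm0 : (0 : ℝ) ≤ m := Nat.cast_nonneg _
  have hj0 : (0 : ℝ) ≤ j := Nat.cast_nonneg _
  rcases (show j = 0 ∨ j = 2 ∨ j = 3 ∨ 4 ≤ j by omega) with rfl | rfl | rfl | hj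
  · norm_num at *
    linarith
  · have := min_le_left (((2 : ℕ) - 1 : ℝ) * ((2 : ℕ) - 2)) (2 * ((2 : ℕ) - 1))
    norm_num at *
    nlinarith
  · have := min_le_left (((3 : ℕ) - 1 : ℝ) * ((3 : ℕ) - 2)) (2 * ((3 : ℕ) - 1))
    push_cast at *
    nlinarith
  · have := min_le_right ((j - 1 : ℝ) * (j - 2)) (2 * (j - 1))
    have h4 : (4 : ℝ) ≤ j := by exact_mod_cast hj
    have e5 : triSum G U U U ≤ 4 * j * (6 + 2 * (j - 1)) := e4.trans (by gcongr)
    nlinarith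

end Main

section Extremal

lemma linkP4Free_of_not_contains {V : Type*} {G : SimpleGraph V} (h : ¬ Contains hatP4 G) :
    LinkP4Free G := by
  intro v a b c d hac had hbd hva hvb hvc hvd hab hbc hcd
  refine h ⟨fun o => o.elim v ![a, b, c, d], ?_, ?_⟩
  · have := hva.ne
    have := hvb.ne
    have := hvc.ne
    have := hvd.ne
    have := hab.ne
    have := hbc.ne
    have := hcd.ne
    rintro (_ | i) (_ | j) hij
    · rfl
    · fin_cases j <;> simp_all
    · fin_cases i <;> simp_all
    · fin_cases i <;> fin_cases j <;> simp_all
  · rintro (_ | i) (_ | j) hij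
    · exact absurd rfl hij.ne
    · fin_cases j <;> simp_all
    · fin_cases i <;> simp_all [SimpleGraph.adj_comm]
    · fin_cases i <;> fin_cases j <;>
        simp_all [hatP4, SimpleGraph.pathGraph_adj, SimpleGraph.adj_comm]

/-- The blow-up: `p` disjoint edges on the vertices below `2 * p`, all joined to the
remaining vertices, which are independent. -/
def extremalGraph (n p : ℕ) : SimpleGraph (Fin n) where
  Adj x y := (x.1 < 2 * p ∧ 2 * p ≤ y.1) ∨ (y.1 < 2 * p ∧ 2 * p ≤ x.1) ∨
    (x.1 < 2 * p ∧ y.1 < 2 * p ∧ x.1 ≠ y.1 ∧ x.1 / 2 = y.1 / 2)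
  symm := ⟨fun x y h => by omega⟩
  loopless := ⟨fun x h => by omega⟩

lemma extremalGraph_adj {n p : ℕ} {x y : Fin n} : (extremalGraph n p).Adj x y ↔
    (x.1 < 2 * p ∧ 2 * p ≤ y.1) ∨ (y.1 < 2 * p ∧ 2 * p ≤ x.1) ∨
    (x.1 < 2 * p ∧ y.1 < 2 * p ∧ x.1 ≠ y.1 ∧ x.1 / 2 = y.1 / 2) := Iff.rfl

lemma not_contains_extremalGraph (n p : ℕ) : ¬ Contains hatP4 (extremalGraph n p) := by
  rintro ⟨f, hf, h⟩
  have hne : ∀ i j : Fin 4, i ≠ j → (f (some i)).1 ≠ (f (some j)).1 := fun i j hij he =>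
    hij (Option.some_injective _ (hf (Fin.ext he)))
  have hv : ∀ i : Fin 4, (extremalGraph n p).Adj (f none) (f (some i)) := fun i =>
    h (by simp [hatP4])
  have hp : ∀ i j : Fin 4, i.1 + 1 = j.1 → (extremalGraph n p).Adj (f (some i)) (f (some j)) :=
    fun i j hij => h (by
      refine ⟨fun he => ?_, Or.inl (Or.inl ⟨i, j, rfl, rfl, ?_⟩)⟩
      · rw [Option.some_injective _ he] at hij; omega
      · rw [SimpleGraph.pathGraph_adj]; exact Or.inl hij)
  have v0 := extremalGraph_adj.1 (hv 0)
  have v1 := extremalGraph_adj.1 (hv 1)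
  have v2 := extremalGraph_adj.1 (hv 2)
  have v3 := extremalGraph_adj.1 (hv 3)
  have p0 := extremalGraph_adj.1 (hp 0 1 rfl)
  have p1 := extremalGraph_adj.1 (hp 1 2 rfl)
  have p2 := extremalGraph_adj.1 (hp 2 3 rfl)
  have n0 := hne 0 2 (by decide)
  have n1 := hne 0 3 (by decide)
  have n2 := hne 1 3 (by decide)
  clear hne hv hp h hf
  generalize (f none).1 = a at *
  generalize (f (some 0)).1 = b at *
  generalize (f (some 1)).1 = c at *
  generalize (f (some 2)).1 = d at *
  generalize (f (some 3)).1 = e at *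
  by_cases ha : a < 2 * p <;> by_cases hb : b < 2 * p <;> by_cases hc : c < 2 * p <;>
    by_cases hd : d < 2 * p <;> omega

lemma mul_le_triangleCount_extremalGraph {n p : ℕ} (hp : 2 * p ≤ n) :
    p * (n - 2 * p) ≤ triangleCount (extremalGraph n p) := by
  classical
  let f : Fin p × Fin (n - 2 * p) → Finset (Fin n) := fun ij =>
    {⟨2 * ij.1.1, by omega⟩, ⟨2 * ij.1.1 + 1, by omega⟩, ⟨2 * p + ij.2.1, by omega⟩}
  have hf : Function.Injective f := by
    rintro ⟨i, j⟩ ⟨i', j'⟩ h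
    have h1 : (⟨2 * i.1, by omega⟩ : Fin n) ∈ f (i', j') := h ▸ Finset.mem_insert_self _ _
    have h2 : (⟨2 * p + j.1, by omega⟩ : Fin n) ∈ f (i', j') := by rw [← h]; simp [f]
    simp only [f, Finset.mem_insert, Finset.mem_singleton, Fin.mk.injEq] at h1 h2
    ext
    · show i.1 = i'.1; omega
    · show j.1 = j'.1; omega
  have hsub : Set.range f ⊆ (extremalGraph n p).cliqueSet 3 := by
    rintro _ ⟨ij, rfl⟩
    rw [SimpleGraph.mem_cliqueSet_iff, SimpleGraph.is3Clique_triple_iff]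
    simp only [extremalGraph_adj]
    omega
  have := Set.ncard_le_ncard hsub (Set.toFinite _)
  rw [Set.ncard_range_of_injective hf] at this
  simpa [triangleCount] using this

end Extremal

/-- For every `n ≥ 8`, `ex(n, K₃, P̂₄) = ⌊n² / 8⌋`. -/
theorem stmt_0 (n : ℕ) (hn : 8 ≤ n) :
    IsGreatest {t : ℕ | ∃ G : SimpleGraph (Fin n),
      ¬ Contains hatP4 G ∧ triangleCount G = t} (n ^ 2 / 8) := by
  have hub : ∀ G : SimpleGraph (Fin n), ¬ Contains hatP4 G → triangleCount G ≤ n ^ 2 / 8 := by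
    intro G hG
    have := (linkP4Free_of_not_contains hG).eight_mul_ncard_le (by simpa using hn)
    rw [Fintype.card_fin] at this
    rw [Nat.le_div_iff_mul_le (by norm_num), mul_comm]
    exact this
  refine ⟨⟨extremalGraph n ((n + 1) / 4), not_contains_extremalGraph _ _, ?_⟩, ?_⟩
  · refine (hub _ (not_contains_extremalGraph _ _)).antisymm
      (le_trans ?_ (mul_le_triangleCount_extremalGraph (by omega)))
    obtain ⟨k, r, hr, rfl⟩ : ∃ k r, r < 4 ∧ n = 4 * k + r :=
      ⟨n / 4, n % 4, Nat.mod_lt _ (by norm_num), by omega⟩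
    rw [← Nat.lt_succ_iff, Nat.div_lt_iff_lt_mul (by norm_num)]
    interval_cases r
    · rw [show (4 * k + 0 + 1) / 4 = k by omega, show 4 * k + 0 - 2 * k = 2 * k by omega]
      simp only [Nat.succ_eq_add_one]; nlinarith
    · rw [show (4 * k + 1 + 1) / 4 = k by omega, show 4 * k + 1 - 2 * k = 2 * k + 1 by omega]
      simp only [Nat.succ_eq_add_one]; nlinarith
    · rw [show (4 * k + 2 + 1) / 4 = k by omega, show 4 * k + 2 - 2 * k = 2 * k + 2 by omega]
      simp only [Nat.succ_eq_add_one]; nlinarith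
    · rw [show (4 * k + 3 + 1) / 4 = k + 1 by omega,
        show 4 * k + 3 - 2 * (k + 1) = 2 * k + 1 by omega]
      simp only [Nat.succ_eq_add_one]; nlinarith
  · rintro _ ⟨G, hG, rfl⟩
    exact hub G hG
end

section
/- Every 8-vertex graph with at least 9 triangles contains a subgraph isomorphic to the suspension of P4. -/
open Finset

/-- No vertex of `G` is joined to all vertices of a path on four vertices: in this form
`P̂₄`-freeness is used below. -/
def FanFree {V : Type*} (G : SimpleGraph V) : Prop :=
  ∀ ⦃a p q r s : V⦄, G.Adj a p → G.Adj a q → G.Adj a r → G.Adj a s →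
    G.Adj p q → G.Adj q r → G.Adj r s → p ≠ r → p ≠ s → q ≠ s → False

lemma fanFree_of_not_contains {V : Type*} {G : SimpleGraph V} (h : ¬ Contains hatP4 G) :
    FanFree G := by
  intro a p q r s hap haq har has hpq hqr hrs hpr hps hqs
  refine h ⟨fun x => x.elim a ![p, q, r, s], ?_, ?_⟩
  · have := hap.ne
    have := haq.ne
    have := har.ne
    have := has.ne
    have := hpq.ne
    have := hqr.ne
    have := hrs.ne
    rintro (_ | i) (_ | j) hij
    · rfl
    · fin_cases j <;> simp_all
    · fin_cases i <;> simp_all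
    · fin_cases i <;> fin_cases j <;> simp_all
  · rintro (_ | i) (_ | j) hij
    · simp [hatP4] at hij
    · fin_cases j <;> simp_all
    · fin_cases i <;> simp_all [SimpleGraph.adj_comm]
    · fin_cases i <;> fin_cases j <;>
        simp_all [hatP4, SimpleGraph.pathGraph_adj, SimpleGraph.adj_comm]

lemma FanFree.mono {V : Type*} {G H : SimpleGraph V} (hG : FanFree G) (hle : H ≤ G) :
    FanFree H :=
  fun _ _ _ _ _ h₁ h₂ h₃ h₄ h₅ h₆ h₇ =>
    hG (hle h₁) (hle h₂) (hle h₃) (hle h₄) (hle h₅) (hle h₆) (hle h₇)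

/-- In a fan-free graph, a vertex outside a 4-clique has at most one neighbour in it. -/
lemma FanFree.eq_of_adj_of_adj {V : Type*} {G : SimpleGraph V} (hG : FanFree G)
    {K : Finset V} (hK : G.IsNClique 4 K) {x y z : V} (hx : x ∉ K) (hy : y ∈ K) (hz : z ∈ K)
    (hxy : G.Adj x y) (hxz : G.Adj x z) : y = z := by
  classical
  by_contra hyz
  have hcard : #((K.erase y).erase z) = 2 := by
    rw [card_erase_of_mem (by grind), card_erase_of_mem hy, hK.card_eq]
  obtain ⟨c, d, hcd, hKcd⟩ := card_eq_two.1 hcard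
  have hc : c ∈ (K.erase y).erase z := by simp [hKcd]
  have hd : d ∈ (K.erase y).erase z := by simp [hKcd]
  simp only [mem_erase] at hc hd
  have adj : ∀ {u v}, u ∈ K → v ∈ K → u ≠ v → G.Adj u v := fun hu hv h => hK.isClique hu hv h
  exact hG hxy.symm (adj hy hz hyz) (adj hy hc.2.2 (Ne.symm hc.2.1))
    (adj hy hd.2.2 (Ne.symm hd.2.1)) hxz (adj hz hc.2.2 (Ne.symm hc.1)) (adj hc.2.2 hd.2.2 hcd)
    (by grind) (by grind) (Ne.symm hd.1)

/-- Two edges of a triangle in a fan-free graph without 4-cliques cannot both lie in further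
triangles. -/
lemma FanFree.not_two_shared {V : Type*} {G : SimpleGraph V} (hG : FanFree G)
    (h4 : G.CliqueFree 4) {x y z u w : V} (hxy : G.Adj x y) (hxz : G.Adj x z) (hyz : G.Adj y z)
    (hux : G.Adj u x) (huz : G.Adj u z) (huy : u ≠ y)
    (hwx : G.Adj w x) (hwy : G.Adj w y) (hwz : w ≠ z) : False := by
  classical
  by_cases huw : u = w
  · subst huw
    exact h4 _ ((SimpleGraph.is3Clique_triple_iff.2 ⟨hxy, hxz, hyz⟩).insert (a := u)
      (by simp [*]))
  · exact hG hwx.symm hxy hxz hux.symm hwy hyz huz.symm hwz (Ne.symm huw) huy.symm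

/-- Every triangle of a fan-free graph without 4-cliques has a vertex both of whose edges in the
triangle lie in no other triangle. -/
lemma FanFree.exists_apex {V : Type*} {G : SimpleGraph V} (hG : FanFree G)
    (h4 : G.CliqueFree 4) {T : Finset V} (hT : G.IsNClique 3 T) :
    ∃ a ∈ T, ∀ b ∈ T, b ≠ a → ∀ c, G.Adj c a → G.Adj c b → c ∈ T := by
  classical
  obtain ⟨x, y, z, hxy, hxz, hyz, rfl⟩ := SimpleGraph.is3Clique_iff.1 hT
  by_contra! h
  obtain ⟨b, hb, hbx, c, hc, hcb, hcT⟩ := h x (by simp)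
  obtain ⟨b', hb', hby, c', hc', hcb', hcT'⟩ := h y (by simp)
  obtain ⟨b'', hb'', hbz, c'', hc'', hcb'', hcT''⟩ := h z (by simp)
  have hno := @FanFree.not_two_shared V G hG h4
  simp only [mem_insert, mem_singleton, not_or] at *
  have := hxy.symm
  have := hxz.symm
  have := hyz.symm
  grind

open Classical in
/-- A fan-free graph without 4-cliques has a triangle-free subgraph with at least two edges for
each of its triangles. -/
lemma FanFree.exists_cliqueFree_subgraph {V : Type*} [Fintype V] {G : SimpleGraph V}
    (hG : FanFree G) (h4 : G.CliqueFree 4) :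
    ∃ H ≤ G, H.CliqueFree 3 ∧ #(G.cliqueFinset 3) * 2 ≤ #H.edgeFinset := by
  by_cases h3 : G.CliqueFree 3
  · exact ⟨G, le_rfl, h3, by simp [G.cliqueFinset_eq_empty_iff.2 h3]⟩
  have : Nonempty V := by
    by_contra hV
    rw [not_nonempty_iff] at hV
    exact h3 (SimpleGraph.cliqueFree_of_card_lt (by simp))
  choose! a haT ha using fun (T : Finset V) (hT : G.IsNClique 3 T) => hG.exists_apex h4 hT
  have huniq : ∀ T T', G.IsNClique 3 T → G.IsNClique 3 T' → ∀ b ∈ T, b ≠ a T → a T ∈ T' →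
      b ∈ T' → T' = T := by
    intro T T' hT hT' b hb hba haT' hbT'
    refine eq_of_subset_of_card_le (fun c hc => ?_) (by rw [hT.card_eq, hT'.card_eq])
    by_cases h₁ : c = a T
    · exact h₁ ▸ haT T hT
    by_cases h₂ : c = b
    · exact h₂ ▸ hb
    exact ha T hT b hb hba c (hT'.isClique hc haT' h₁) (hT'.isClique hc hbT' h₂)
  obtain ⟨H, hH⟩ : ∃ H : SimpleGraph V, ∀ x y, H.Adj x y ↔ G.Adj x y ∧
      ∀ T, G.IsNClique 3 T → x ∈ T → y ∈ T → a T = x ∨ a T = y :=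
    ⟨{ Adj := fun x y => G.Adj x y ∧ ∀ T, G.IsNClique 3 T → x ∈ T → y ∈ T → a T = x ∨ a T = y
       symm := ⟨fun x y h => ⟨h.1.symm, fun T hT hx hy => (h.2 T hT hy hx).symm⟩⟩
       loopless := ⟨fun x h => G.loopless.irrefl x h.1⟩ }, fun _ _ => Iff.rfl⟩
  have hle : H ≤ G := fun x y h => ((hH x y).1 h).1
  refine ⟨H, hle, ?_, ?_⟩
  · intro T hT
    have hTG := hT.mono hle
    obtain ⟨x, y, z, hxy, hxz, hyz, rfl⟩ := SimpleGraph.is3Clique_iff.1 hT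
    have h₁ := ((hH _ _).1 hxy).2 _ hTG (by simp) (by simp)
    have h₂ := ((hH _ _).1 hxz).2 _ hTG (by simp) (by simp)
    have h₃ := ((hH _ _).1 hyz).2 _ hTG (by simp) (by simp)
    have := hxy.ne
    have := hxz.ne
    have := hyz.ne
    grind
  · let E : Finset V → Finset (Sym2 V) := fun T => (T.erase (a T)).image fun b => s(a T, b)
    have hE : ∀ T ∈ G.cliqueFinset 3, #(E T) = 2 := by
      intro T hT
      rw [SimpleGraph.mem_cliqueFinset_iff] at hT
      rw [card_image_of_injective _ fun b c h => Sym2.congr_right.1 h,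
        card_erase_of_mem (haT T hT), hT.card_eq]
    have hdisj : ((G.cliqueFinset 3 : Finset (Finset V)) : Set (Finset V)).PairwiseDisjoint E := by
      intro T hT T' hT' hne
      simp only [mem_coe, SimpleGraph.mem_cliqueFinset_iff] at hT hT'
      refine disjoint_left.2 fun e he he' => hne ?_
      simp only [E, mem_image, mem_erase] at he he'
      obtain ⟨b, ⟨hba, hb⟩, rfl⟩ := he
      obtain ⟨c, ⟨hca, hc⟩, hcb⟩ := he'
      have haT' := haT T' hT'
      rw [Sym2.eq_iff] at hcb
      refine (huniq T T' hT hT' b hb hba ?_ ?_).symm <;> grind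
    rw [← sum_const_nat hE, ← card_biUnion hdisj]
    refine card_le_card fun e he => ?_
    simp only [E, mem_biUnion, mem_image, mem_erase, SimpleGraph.mem_cliqueFinset_iff] at he
    obtain ⟨T, hT, b, ⟨hba, hb⟩, rfl⟩ := he
    rw [SimpleGraph.mem_edgeFinset, SimpleGraph.mem_edgeSet, hH]
    refine ⟨hT.isClique (haT T hT) hb (Ne.symm hba), fun T' hT' h₁ h₂ => ?_⟩
    exact .inl (by rw [huniq T T' hT hT' b hb hba h₁ h₂])

open Classical in
/-- Two different 4-cliques of a fan-free graph on 8 vertices that share no edge contain all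
triangles. -/
lemma FanFree.card_triangles_le_of_two_cliques {V : Type*} [Fintype V] {G : SimpleGraph V}
    (hG : FanFree G) (hcard : Fintype.card V = 8) {K L : Finset V} (hK : G.IsNClique 4 K)
    (hL : G.IsNClique 4 L) (hKL : #(K ∩ L) ≤ 1) : #(G.cliqueFinset 3) ≤ 8 := by
  have hsub : G.cliqueFinset 3 ⊆ K.powersetCard 3 ∪ L.powersetCard 3 := by
    intro T hT
    rw [SimpleGraph.mem_cliqueFinset_iff] at hT
    have inter_le : ∀ M, G.IsNClique 4 M → ¬ T ⊆ M → #(T ∩ M) ≤ 1 := by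
      intro M hM hTM
      obtain ⟨x, hxT, hxM⟩ := not_subset.1 hTM
      refine card_le_one.2 fun y hy z hz => ?_
      rw [mem_inter] at hy hz
      exact hG.eq_of_adj_of_adj hM hxM hy.2 hz.2 (hT.isClique hxT hy.1 (by grind))
        (hT.isClique hxT hz.1 (by grind))
    simp only [mem_union, mem_powersetCard, hT.card_eq, and_true]
    by_contra! hnot
    have hTK := inter_le K hK hnot.1
    have hTL := inter_le L hL hnot.2
    have hunion := card_union_add_card_inter K L
    rw [hK.card_eq, hL.card_eq] at hunion
    have hout : #(T \ (K ∪ L)) ≤ #(univ \ (K ∪ L)) :=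
      card_le_card (sdiff_subset_sdiff (subset_univ T) subset_rfl)
    rw [card_sdiff_of_subset (subset_univ _), card_univ, hcard] at hout
    have hin : #(T ∩ (K ∪ L)) + #(T ∩ (K ∩ L)) = #(T ∩ K) + #(T ∩ L) := by
      rw [← card_union_add_card_inter (T ∩ K) (T ∩ L), inter_union_distrib_left,
        inter_inter_distrib_left]
    have hT3 := card_inter_add_card_sdiff T (K ∪ L)
    rw [hT.card_eq] at hT3
    obtain ⟨v, hv⟩ := card_eq_one.1 (show #(K ∩ L) = 1 by lia)
    obtain ⟨x, hx⟩ := card_eq_one.1 (show #(T ∩ K) = 1 by lia)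
    obtain ⟨y, hy⟩ := card_eq_one.1 (show #(T ∩ L) = 1 by lia)
    have hempty := card_eq_zero.1 (show #(T ∩ (K ∩ L)) = 0 by lia)
    simp only [Finset.ext_iff, mem_inter, mem_singleton, notMem_empty, iff_false] at hv hx hy hempty
    have hv' := (hv v).2 rfl
    have hx' := (hx x).2 rfl
    have hy' := (hy y).2 rfl
    have hvx : v = x := hG.eq_of_adj_of_adj hK (x := y) (by grind) hv'.1 hx'.2
      (hL.isClique hy'.2 hv'.2 (by grind)) (hT.isClique hy'.1 hx'.1 (by grind))
    grind
  calc #(G.cliqueFinset 3) ≤ #(K.powersetCard 3 ∪ L.powersetCard 3) := card_le_card hsub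
    _ ≤ #(K.powersetCard 3) + #(L.powersetCard 3) := card_union_le _ _
    _ = 8 := by simp [card_powersetCard, hK.card_eq, hL.card_eq]

open Classical in
/-- A triangle-free graph on 8 vertices with an independent set `K` of size 4 such that every
other vertex has at most one neighbour in `K` has at most 8 edges. -/
lemma card_edgeFinset_le_of_independent {V : Type*} [Fintype V] {H : SimpleGraph V}
    (hcard : Fintype.card V = 8) (h3 : H.CliqueFree 3) {K : Finset V} (hKcard : #K = 4)
    (hK : ∀ x ∈ K, ∀ y ∈ K, ¬ H.Adj x y)
    (hone : ∀ x ∉ K, ∀ y ∈ K, ∀ z ∈ K, H.Adj x y → H.Adj x z → y = z) :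
    #H.edgeFinset ≤ 8 := by
  have hchoice : ∀ x, ∃ c, x ∉ K → ∀ y ∈ K, H.Adj x y → y = c := by
    intro x
    by_cases h : ∃ c ∈ K, H.Adj x c
    · obtain ⟨c, hc, hxc⟩ := h
      exact ⟨c, fun hx y hy hxy => hone x hx y hy c hc hxy hxc⟩
    · exact ⟨x, fun _ y hy hxy => (h ⟨y, hy, hxy⟩).elim⟩
  choose c hc using hchoice
  let I := H.induce {x | x ∉ K}
  have hIcard : Fintype.card {x | x ∉ K} = 4 := by
    have := Fintype.card_subtype_compl (· ∈ K)
    rw [hcard, Fintype.card_coe, hKcard] at this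
    exact this
  have hI : #I.edgeFinset ≤ 4 := by
    have := (h3.comap ⟨(SimpleGraph.Embedding.induce {x | x ∉ K}).toCopy⟩).card_edgeFinset_le (r := 2)
    rw [hIcard] at this
    exact this
  have hsub : H.edgeFinset ⊆
      I.edgeFinset.image (Sym2.map Subtype.val) ∪ Kᶜ.image fun x => s(x, c x) := by
    intro e
    induction e with
    | _ x y =>
      intro he
      rw [SimpleGraph.mem_edgeFinset, SimpleGraph.mem_edgeSet] at he
      rw [mem_union, mem_image, mem_image]
      by_cases hx : x ∈ K
      · have hy : y ∉ K := fun hy => hK x hx y hy he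
        exact .inr ⟨y, by simpa using hy, by rw [← hc y hy x hx he.symm, Sym2.eq_swap]⟩
      · by_cases hy : y ∈ K
        · exact .inr ⟨x, by simpa using hx, by rw [← hc x hx y hy he]⟩
        · exact .inl ⟨s(⟨x, hx⟩, ⟨y, hy⟩), by simpa [I] using he, rfl⟩
  calc #H.edgeFinset ≤ _ := card_le_card hsub
    _ ≤ #(I.edgeFinset.image (Sym2.map Subtype.val)) + #(Kᶜ.image fun x => s(x, c x)) :=
        card_union_le _ _
    _ ≤ #I.edgeFinset + #Kᶜ := add_le_add card_image_le card_image_le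
    _ ≤ 8 := by rw [card_compl, hcard, hKcard]; lia

open Classical in
lemma FanFree.card_triangles_le_of_clique {V : Type*} [Fintype V] {G : SimpleGraph V}
    (hG : FanFree G) (hcard : Fintype.card V = 8) {K : Finset V} (hK : G.IsNClique 4 K) :
    #(G.cliqueFinset 3) ≤ 8 := by
  let G' : SimpleGraph V :=
    { Adj := fun x y => G.Adj x y ∧ ¬ (x ∈ K ∧ y ∈ K)
      symm := ⟨fun x y h => ⟨h.1.symm, fun h' => h.2 h'.symm⟩⟩
      loopless := ⟨fun x h => G.loopless.irrefl x h.1⟩ }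
  have hle : G' ≤ G := fun x y h => h.1
  by_cases h4 : G'.CliqueFree 4
  · obtain ⟨H, hHG', hH3, hH⟩ := (hG.mono hle).exists_cliqueFree_subgraph h4
    have hHcard : #H.edgeFinset ≤ 8 :=
      card_edgeFinset_le_of_independent hcard hH3 hK.card_eq
        (fun x hx y hy h => (hHG' h).2 ⟨hx, hy⟩)
        (fun x hx y hy z hz hxy hxz => hG.eq_of_adj_of_adj hK hx hy hz (hHG' hxy).1 (hHG' hxz).1)
    have hsub : G.cliqueFinset 3 ⊆ K.powersetCard 3 ∪ G'.cliqueFinset 3 := by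
      intro T hT
      rw [SimpleGraph.mem_cliqueFinset_iff] at hT
      simp only [mem_union, mem_powersetCard, hT.card_eq, and_true,
        SimpleGraph.mem_cliqueFinset_iff]
      refine or_iff_not_imp_left.2 fun hTK => ⟨fun y hy z hz hyz => ?_, hT.card_eq⟩
      obtain ⟨x, hxT, hxK⟩ := not_subset.1 hTK
      refine ⟨hT.isClique hy hz hyz, fun h => hyz ?_⟩
      exact hG.eq_of_adj_of_adj hK hxK h.1 h.2 (hT.isClique hxT hy (by grind))
        (hT.isClique hxT hz (by grind))
    have hKtri : #(K.powersetCard 3) = 4 := by simp [card_powersetCard, hK.card_eq]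
    have := (card_le_card hsub).trans (card_union_le _ _)
    lia
  · simp only [SimpleGraph.CliqueFree, not_forall, not_not] at h4
    obtain ⟨L, hL⟩ := h4
    refine hG.card_triangles_le_of_two_cliques hcard hK (hL.mono hle) (card_le_one.2 ?_)
    intro x hx y hy
    rw [mem_inter] at hx hy
    by_contra hxy
    exact (hL.isClique hx.2 hy.2 hxy).2 ⟨hx.1, hy.1⟩

/-- Every `8`-vertex graph with at least `9` triangles contains `P̂₄` as a subgraph. -/
theorem stmt_6 {V : Type} [Fintype V] (G : SimpleGraph V)
    (hcard : Fintype.card V = 8) (ht : 9 ≤ triangleCount G) :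
    Contains hatP4 G := by
  classical
  by_contra hcon
  have hG := fanFree_of_not_contains hcon
  rw [triangleCount, ← SimpleGraph.coe_cliqueFinset, Set.ncard_coe_finset] at ht
  suffices #(G.cliqueFinset 3) ≤ 8 by lia
  by_cases h4 : G.CliqueFree 4
  · obtain ⟨H, -, hH3, hH⟩ := hG.exists_cliqueFree_subgraph h4
    have hmantel : #H.edgeFinset ≤ 16 := by
      have := hH3.card_edgeFinset_le (r := 2)
      rw [hcard] at this
      exact this
    convert! (show #(G.cliqueFinset 3) ≤ 8 by lia)
  · simp only [SimpleGraph.CliqueFree, not_forall, not_not] at h4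
    obtain ⟨K, hK⟩ := h4
    convert! hG.card_triangles_le_of_clique hcard hK
end

section
/- Every 9-vertex graph with at least 11 triangles contains a subgraph isomorphic to the suspension of P4. -/
namespace SimpleGraph

open Finset

/-- No neighbourhood of `G` contains a path on four vertices. -/
def FanFree {V : Type*} (G : SimpleGraph V) : Prop :=
  ∀ ⦃v p q r s : V⦄, G.Adj v p → G.Adj v q → G.Adj v r → G.Adj v s →
    G.Adj p q → G.Adj q r → G.Adj r s → p ≠ r → p ≠ s → q ≠ s → False

section

variable {V : Type*} {G H : SimpleGraph V}

theorem fanFree_of_not_contains (h : ¬ Contains hatP4 G) : G.FanFree := by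
  intro v p q r s hp hq hr hs pq qr rs hpr hps hqs
  refine h ⟨fun o => o.elim v ![p, q, r, s], ?_, ?_⟩
  · have := hp.ne; have := hq.ne; have := hr.ne; have := hs.ne
    have := pq.ne; have := qr.ne; have := rs.ne
    rintro (_ | i) (_ | j) hij
    · rfl
    · fin_cases j <;> simp_all
    · fin_cases i <;> simp_all
    · fin_cases i <;> fin_cases j <;> simp_all
  · rintro (_ | i) (_ | j) hij
    · exact (hij.ne rfl).elim
    · fin_cases j <;> simpa
    · fin_cases i <;> simpa [G.adj_comm _ v]
    · fin_cases i <;> fin_cases j <;>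
        simp_all [hatP4, pathGraph_adj, G.adj_comm]

theorem FanFree.mono (hle : H ≤ G) (hG : G.FanFree) : H.FanFree :=
  fun _ _ _ _ _ h₁ h₂ h₃ h₄ h₅ h₆ h₇ =>
    hG (hle h₁) (hle h₂) (hle h₃) (hle h₄) (hle h₅) (hle h₆) (hle h₇)

/-- In a fan-free graph, a vertex outside a 4-clique has at most one neighbour in it. -/
theorem FanFree.eq_of_adj_of_isNClique_four [DecidableEq V] (hG : G.FanFree) {A : Finset V}
    (hA : G.IsNClique 4 A) {v x y : V} (hv : v ∉ A) (hx : x ∈ A) (hy : y ∈ A)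
    (hvx : G.Adj v x) (hvy : G.Adj v y) : x = y := by
  by_contra hxy
  have hcard : #((A.erase x).erase y) = 2 := by
    rw [card_erase_of_mem (by grind), card_erase_of_mem hx, hA.card_eq]
  obtain ⟨z, z', hzz, hz⟩ := card_eq_two.1 hcard
  have hzm : z ∈ (A.erase x).erase y := by simp [hz]
  have hzm' : z' ∈ (A.erase x).erase y := by simp [hz]
  simp only [mem_erase] at hzm hzm'
  have adj : ∀ a ∈ A, ∀ b ∈ A, a ≠ b → G.Adj a b := fun a ha b hb => hA.1 ha hb
  refine hG (v := x) (p := v) (q := y) (r := z) (s := z') hvx.symm ?_ ?_ ?_ hvy ?_ ?_ ?_ ?_ ?_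
    <;> grind

/-- A 3-clique not inside a 4-clique of a fan-free graph meets it in at most one vertex. -/
theorem FanFree.card_inter_le_one [DecidableEq V] (hG : G.FanFree) {A T : Finset V}
    (hA : G.IsNClique 4 A) (hT : G.IsClique T) (hTA : ¬ T ⊆ A) : #(T ∩ A) ≤ 1 := by
  obtain ⟨v, hv, hvA⟩ := not_subset.1 hTA
  refine card_le_one.2 fun x hx y hy => ?_
  rw [mem_inter] at hx hy
  exact hG.eq_of_adj_of_isNClique_four hA hvA hx.2 hy.2 (hT hv hx.1 (by grind))
    (hT hv hy.1 (by grind))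

theorem FanFree.card_filter_adj_le_one [DecidableEq V] [DecidableRel G.Adj] (hG : G.FanFree)
    {A : Finset V} (hA : G.IsNClique 4 A) {v : V} (hv : v ∉ A) : #{x ∈ A | G.Adj v x} ≤ 1 := by
  refine card_le_one.2 fun x hx y hy => ?_
  rw [mem_filter] at hx hy
  exact hG.eq_of_adj_of_isNClique_four hA hv hx.1 hy.1 hx.2 hy.2

/-- In a fan-free graph without 4-cliques, every triangle has a vertex both of whose triangle
edges lie in no other triangle. -/
theorem FanFree.exists_private_vertex [DecidableEq V] (hG : G.FanFree) (hK : G.CliqueFree 4)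
    {T : Finset V} (hT : G.IsNClique 3 T) :
    ∃ v ∈ T, ∀ x ∈ T, x ≠ v → ∀ p, G.Adj p v → G.Adj p x → p ∈ T := by
  have key : ∀ x y z, T = {x, y, z} → G.Adj x y → G.Adj x z → G.Adj y z →
      (∀ p, G.Adj p x → G.Adj p y → p ∈ T) ∨ (∀ p, G.Adj p x → G.Adj p z → p ∈ T) := by
    intro x y z hxyz xy xz yz
    by_contra! hcon
    obtain ⟨⟨p, px, py, hp⟩, q, qx, qz, hq⟩ := hcon
    have hpq : p ≠ q := by
      rintro rfl
      refine hK (insert p {x, y, z}) ((is3Clique_triple_iff.2 ⟨xy, xz, yz⟩).insert ?_)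
      simp [px, py, qz]
    exact hG px.symm xy xz qx.symm py yz qz.symm (by grind) hpq (by grind)
  obtain ⟨a, b, c, ab, ac, bc, habc⟩ := is3Clique_iff.1 hT
  have h₁ := key a b c habc ab ac bc
  have h₂ := key b a c (by grind) ab.symm bc ac
  have h₃ := key c a b (by grind) ac.symm bc.symm ab
  have sw : ∀ {x y : V}, (∀ p, G.Adj p x → G.Adj p y → p ∈ T) →
      ∀ p, G.Adj p y → G.Adj p x → p ∈ T := fun h p hy hx => h p hx hy
  have pick : ∀ x y z, T = {x, y, z} → (∀ p, G.Adj p x → G.Adj p y → p ∈ T) →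
      (∀ p, G.Adj p x → G.Adj p z → p ∈ T) →
      ∃ v ∈ T, ∀ x ∈ T, x ≠ v → ∀ p, G.Adj p v → G.Adj p x → p ∈ T := by
    intro x y z hxyz hy hz
    refine ⟨x, by simp [hxyz], fun w hw hwx => ?_⟩
    have : w = y ∨ w = z := by
      simpa [hxyz, hwx] using hw
    rcases this with rfl | rfl
    exacts [hy, hz]
  rcases h₁ with h₁ | h₁ <;> rcases h₃ with h₃ | h₃
  · exact pick a b c habc h₁ (sw h₃)
  · rcases h₂ with h₂ | h₂
    · exact pick b a c (by grind) h₂ (sw h₃)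
    · exact pick b a c (by grind) (sw h₁) h₂
  · rcases h₂ with h₂ | h₂
    · exact pick a b c habc (sw h₂) h₁
    · exact pick c a b (by grind) h₃ (sw h₂)
  · exact pick c a b (by grind) (sw h₁) h₃

end

section

variable {V : Type*} [Fintype V] [DecidableEq V] {G : SimpleGraph V}

open Classical in
/-- A fan-free graph without 4-cliques has a triangle-free subgraph with at least twice as many
edges as there are triangles. -/
theorem FanFree.exists_cliqueFree_three [DecidableRel G.Adj] (hG : G.FanFree)
    (hK : G.CliqueFree 4) :
    ∃ F ≤ G, F.CliqueFree 3 ∧ 2 * #(G.cliqueFinset 3) ≤ #F.edgeFinset := by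
  obtain hV | hV := isEmpty_or_nonempty V
  · have h := G.card_cliqueFinset_le (n := 3)
    rw [Fintype.card_eq_zero, Nat.choose_zero_succ] at h
    exact ⟨⊥, bot_le, cliqueFree_bot (by norm_num), by lia⟩
  have hex : ∀ T : Finset V, G.IsNClique 3 T →
      ∃ v ∈ T, ∀ x ∈ T, x ≠ v → ∀ p, G.Adj p v → G.Adj p x → p ∈ T :=
    fun T hT => hG.exists_private_vertex hK hT
  choose! f hfT hf using hex
  let E : Finset (Sym2 V) :=
    (G.cliqueFinset 3).biUnion fun T => (T.erase (f T)).image fun x => s(f T, x)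
  have hE : ∀ {x y}, s(x, y) ∈ E → ∃ T, G.IsNClique 3 T ∧ x ∈ T ∧ y ∈ T ∧ x ≠ y ∧
      (f T = x ∨ f T = y) ∧ ∀ p, G.Adj p x → G.Adj p y → p ∈ T := by
    intro x y hxy
    simp only [E, mem_biUnion, mem_cliqueFinset_iff, mem_image, mem_erase] at hxy
    obtain ⟨T, hT, z, ⟨hz, hzT⟩, hxy⟩ := hxy
    have hp := hf T hT z hzT hz
    have hv := hfT T hT
    refine ⟨T, hT, ?_⟩
    rcases Sym2.eq_iff.1 hxy with ⟨rfl, rfl⟩ | ⟨rfl, rfl⟩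
    · exact ⟨hv, hzT, hz.symm, Or.inl rfl, hp⟩
    · exact ⟨hzT, hv, hz, Or.inr rfl, fun p h₁ h₂ => hp p h₂ h₁⟩
  obtain ⟨F, hadj⟩ : ∃ F : SimpleGraph V, ∀ {x y}, F.Adj x y ↔ s(x, y) ∈ E := by
    refine ⟨fromEdgeSet E, fun {x y} => ?_⟩
    rw [fromEdgeSet_adj, mem_coe, and_iff_left_iff_imp]
    intro h
    obtain ⟨T, -, -, -, hne, -⟩ := hE h
    exact hne
  have hle : F ≤ G := by
    intro x y hxy
    obtain ⟨T, hT, hx, hy, hne, -⟩ := hE (hadj.1 hxy)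
    exact hT.1 hx hy hne
  refine ⟨F, hle, ?_, ?_⟩
  · intro S hS
    obtain ⟨a, b, c, ab, ac, bc, -⟩ := is3Clique_iff.1 hS
    have htri : ∀ {x y z}, s(x, y) ∈ E → G.Adj z x → G.Adj z y →
        f {x, y, z} = x ∨ f {x, y, z} = y := by
      intro x y z hxy hzx hzy
      obtain ⟨T, hT, hx, hy, hne, hfT, hp⟩ := hE hxy
      have hTeq : {x, y, z} = T := by
        refine eq_of_subset_of_card_le ?_ ?_
        · simp only [insert_subset_iff, singleton_subset_iff]
          exact ⟨hx, hy, hp z hzx hzy⟩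
        · rw [hT.card_eq, card_eq_three.2 ⟨x, y, z, hne, hzx.ne.symm, hzy.ne.symm, rfl⟩]
      rwa [hTeq]
    have h₁ := htri (hadj.1 ab) (hle ac).symm (hle bc).symm
    have h₂ := htri (hadj.1 ac) (hle ab).symm (hle bc)
    have h₃ := htri (hadj.1 bc) (hle ab) (hle ac)
    rw [pair_comm c b] at h₂
    rw [pair_comm c a, insert_comm b a] at h₃
    rcases h₁ with h₁ | h₁
    · rw [h₁] at h₃
      exact h₃.elim ab.ne ac.ne
    · rw [h₁] at h₂
      exact h₂.elim ab.ne' bc.ne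
  · refine le_trans (le_of_eq ?_) (card_le_card (s := E) fun e => ?_)
    swap
    · induction e with | h x y =>
      exact fun he => mem_edgeFinset.2 (hadj.2 he)
    rw [card_biUnion, sum_const_nat (m := 2), mul_comm]
    · intro T hT
      rw [mem_cliqueFinset_iff] at hT
      rw [card_image_of_injective _ (fun x y h => Sym2.congr_right.1 h),
        card_erase_of_mem (hfT T hT), hT.card_eq]
    · intro T hT T' hT' hne
      rw [mem_coe, mem_cliqueFinset_iff] at hT hT'
      rw [Function.onFun, Finset.disjoint_left]
      simp only [mem_image, mem_erase]
      rintro _ ⟨x, ⟨hx, hxT⟩, rfl⟩ ⟨y, ⟨hy, hyT⟩, heq⟩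
      have hmem : f T ∈ T' ∧ x ∈ T' := by
        have := hfT T' hT'
        rcases Sym2.eq_iff.1 heq with ⟨h₁, h₂⟩ | ⟨h₁, h₂⟩ <;> grind
      refine hne (eq_of_subset_of_card_le (fun p hp => ?_)
        (by rw [hT.card_eq, hT'.card_eq])).symm
      by_cases h₁ : p = f T
      · exact h₁ ▸ hfT T hT
      by_cases h₂ : p = x
      · exact h₂ ▸ hxT
      exact hf T hT x hxT hx p (hT'.1 hp hmem.1 h₁) (hT'.1 hp hmem.2 h₂)

/-- A fan-free graph on nine vertices with two 4-cliques has at most ten triangles. -/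
theorem FanFree.card_cliqueFinset_three_le_of_two_cliques [DecidableRel G.Adj] (hG : G.FanFree)
    (hcard : Fintype.card V = 9) {A B : Finset V} (hA : G.IsNClique 4 A) (hB : G.IsNClique 4 B)
    (hAB : A ≠ B) : #(G.cliqueFinset 3) ≤ 10 := by
  have hBA : ¬ B ⊆ A := fun h =>
    hAB (eq_of_subset_of_card_le h (by rw [hA.card_eq, hB.card_eq])).symm
  have hinter := hG.card_inter_le_one hA hB.1 hBA
  set R := (A ∪ B)ᶜ with hR
  have hRcard : #R + 8 = 9 + #(B ∩ A) := by
    have h₁ := card_union_add_card_inter A B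
    have h₂ := card_add_card_compl (A ∪ B)
    rw [inter_comm, hA.card_eq, hB.card_eq] at h₁
    lia
  obtain ⟨u, hu⟩ : R.Nonempty := card_pos.1 (by lia)
  have hmemR : ∀ {x}, x ∈ R ↔ x ∉ A ∧ x ∉ B := by simp [hR]
  obtain ⟨huA, huB⟩ := hmemR.1 hu
  set N := {x ∈ A | G.Adj u x} ∪ {x ∈ B | G.Adj u x} with hN
  have hNcard : #N ≤ 2 := (card_union_le _ _).trans
    (add_le_add (hG.card_filter_adj_le_one hA huA) (hG.card_filter_adj_le_one hB huB))
  have hRT : ∀ T, G.IsNClique 3 T → ¬ T ⊆ A → ¬ T ⊆ B → R ⊆ T := by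
    intro T hT hTA hTB
    have h₁ := hG.card_inter_le_one hA hT.1 hTA
    have h₂ := hG.card_inter_le_one hB hT.1 hTB
    have hsplit : T = (T ∩ A) ∪ (T ∩ B) ∪ (T ∩ R) := by
      ext x
      simp only [hR, mem_union, mem_inter, mem_compl]
      tauto
    have h₃ : 3 ≤ #((T ∩ A) ∪ (T ∩ B)) + #(T ∩ R) := by
      rw [← hT.card_eq]
      conv_lhs => rw [hsplit]
      exact card_union_le _ _
    by_contra hcon
    have h₄ : #(T ∩ R) < #R :=
      card_lt_card ⟨inter_subset_right, fun h => hcon (h.trans inter_subset_left)⟩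
    have h₅ := card_union_le (T ∩ A) (T ∩ B)
    obtain ⟨a, ha⟩ : (B ∩ A).Nonempty := card_pos.1 (by lia)
    obtain ⟨x, hx⟩ := card_eq_one.1 (show #(T ∩ A) = 1 by lia)
    obtain ⟨y, hy⟩ := card_eq_one.1 (show #(T ∩ B) = 1 by lia)
    have hxy : x ≠ y := by
      rintro rfl
      rw [hx, hy, union_idempotent, card_singleton] at h₃
      lia
    have hxT : x ∈ T ∩ A := by simp [hx]
    have hyT : y ∈ T ∩ B := by simp [hy]
    have hya : y ∉ A := by
      intro h
      have : y ∈ T ∩ A := by grind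
      rw [hx, mem_singleton] at this
      exact hxy this.symm
    have hxa : x = a := by
      refine hG.eq_of_adj_of_isNClique_four hA hya (by grind) (by grind)
        (hT.1 ?_ ?_ hxy.symm) (hB.1 ?_ ?_ ?_) <;> grind
    have : x ∈ T ∩ B := by grind
    rw [hy, mem_singleton] at this
    exact hxy this
  have hsub : G.cliqueFinset 3 ⊆ A.powersetCard 3 ∪ B.powersetCard 3 ∪
      (N.powersetCard (3 - #R)).image (R ∪ ·) := by
    intro T hT
    rw [mem_cliqueFinset_iff] at hT
    simp only [mem_union, mem_powersetCard, hT.card_eq, and_true, mem_image]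
    by_cases hTA : T ⊆ A
    · exact Or.inl (Or.inl hTA)
    by_cases hTB : T ⊆ B
    · exact Or.inl (Or.inr hTB)
    have hRT := hRT T hT hTA hTB
    refine Or.inr ⟨T \ R, ⟨fun x hx => ?_, ?_⟩, union_sdiff_of_subset hRT⟩
    · obtain ⟨hxT, hxR⟩ := mem_sdiff.1 hx
      have hux : G.Adj u x := hT.1 (hRT hu) hxT fun h => hxR (h ▸ hu)
      simp only [hN, mem_union, mem_filter, hux, and_true]
      by_contra! h
      exact hxR (hmemR.2 h)
    · rw [card_sdiff_of_subset hRT, hT.card_eq]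
  have hchoose : (#N).choose (3 - #R) ≤ 2 := by
    have : #R = 1 ∨ #R = 2 := by lia
    rcases this with h | h <;> rw [h] <;> interval_cases #N <;> decide
  calc #(G.cliqueFinset 3) ≤ _ := card_le_card hsub
    _ ≤ 4 + 4 + 2 := by
      refine (card_union_le _ _).trans (add_le_add ((card_union_le _ _).trans ?_) ?_)
      · simp [hA.card_eq, hB.card_eq]
      · exact card_image_le.trans (by rwa [card_powersetCard])

/-- A triangle-free graph on nine vertices has at most eleven edges if it has an independent set of
four vertices in which every other vertex has at most one neighbour. -/
theorem CliqueFree.card_edgeFinset_le_eleven {F : SimpleGraph V} [DecidableRel F.Adj]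
    (hF : F.CliqueFree 3) (hcard : Fintype.card V = 9) {A : Finset V} (hA : #A = 4)
    (hind : ∀ x ∈ A, ∀ y ∈ A, ¬ F.Adj x y)
    (hone : ∀ v ∉ A, ∀ x ∈ A, ∀ y ∈ A, F.Adj v x → F.Adj v y → x = y) :
    #F.edgeFinset ≤ 11 := by
  classical
  have hAc : #Aᶜ = 5 := by rw [card_compl, hcard, hA]
  let K := F.induce {v | v ∉ A}
  have hK : #K.edgeFinset ≤ 6 := by
    have h := CliqueFree.card_edgeFinset_le (r := 2)
      ((cliqueFree_induce_iff ..).2 hF.cliqueFreeOn : K.CliqueFree 3)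
    have h5 : Fintype.card {v | v ∉ A} = 5 := by
      rw [← hAc, ← Fintype.card_coe]
      exact Fintype.card_congr (Equiv.subtypeEquivRight (by simp))
    simpa [h5] using h
  let g : V → V := fun v => if h : ∃ x ∈ A, F.Adj v x then h.choose else v
  have hg : ∀ v ∉ A, ∀ x ∈ A, F.Adj v x → g v = x := by
    intro v hv x hx hvx
    have h : ∃ x ∈ A, F.Adj v x := ⟨x, hx, hvx⟩
    simp only [g, dif_pos h]
    exact hone v hv _ h.choose_spec.1 _ hx h.choose_spec.2 hvx
  have hsub : F.edgeFinset ⊆ K.edgeFinset.image (Sym2.map Subtype.val) ∪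
      Aᶜ.image fun v => s(v, g v) := by
    intro e
    induction e with | h x y =>
    intro he
    rw [mem_edgeFinset, mem_edgeSet] at he
    rw [mem_union, mem_image, mem_image]
    by_cases hx : x ∈ A
    · have hy : y ∉ A := fun hy => hind x hx y hy he
      exact Or.inr ⟨y, by simpa using hy, by rw [hg y hy x hx he.symm, Sym2.eq_swap]⟩
    · by_cases hy : y ∈ A
      · exact Or.inr ⟨x, by simpa using hx, by rw [hg x hx y hy he]⟩
      · exact Or.inl ⟨s(⟨x, hx⟩, ⟨y, hy⟩), by simpa [K] using he, by simp⟩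
  calc #F.edgeFinset ≤ _ := card_le_card hsub
    _ ≤ 6 + 5 := (card_union_le _ _).trans
      (add_le_add (card_image_le.trans hK) (card_image_le.trans hAc.le))

/-- A fan-free graph on nine vertices has at most ten triangles. -/
theorem FanFree.card_cliqueFinset_three_le [DecidableRel G.Adj] (hG : G.FanFree)
    (hcard : Fintype.card V = 9) : #(G.cliqueFinset 3) ≤ 10 := by
  classical
  by_cases hK : G.CliqueFree 4
  · obtain ⟨F, -, hF, h⟩ := hG.exists_cliqueFree_three hK
    have := CliqueFree.card_edgeFinset_le (r := 2) hF
    norm_num [hcard] at this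
    lia
  rw [CliqueFree] at hK
  push Not at hK
  obtain ⟨A, hA⟩ := hK
  let G' : SimpleGraph V :=
    { Adj := fun x y => G.Adj x y ∧ ¬ (x ∈ A ∧ y ∈ A)
      symm := ⟨fun x y h => ⟨h.1.symm, fun h' => h.2 h'.symm⟩⟩
      loopless := ⟨fun x h => G.loopless.irrefl x h.1⟩ }
  have hle : G' ≤ G := fun x y h => h.1
  by_cases hK' : G'.CliqueFree 4
  · obtain ⟨F, hFG, hF, h⟩ := (hG.mono hle).exists_cliqueFree_three hK'
    have hF11 := hF.card_edgeFinset_le_eleven hcard hA.card_eq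
      (fun x hx y hy hxy => (hFG hxy).2 ⟨hx, hy⟩)
      (fun v hv x hx y hy hvx hvy => hG.eq_of_adj_of_isNClique_four hA hv hx hy
        (hle (hFG hvx)) (hle (hFG hvy)))
    have hsub : G.cliqueFinset 3 ⊆ A.powersetCard 3 ∪ G'.cliqueFinset 3 := by
      intro T hT
      rw [mem_cliqueFinset_iff] at hT
      rw [mem_union, mem_powersetCard, mem_cliqueFinset_iff]
      by_cases hTA : T ⊆ A
      · exact Or.inl ⟨hTA, hT.card_eq⟩
      · refine Or.inr ⟨fun x hx y hy hxy => ⟨hT.1 hx hy hxy, fun hA' => hxy ?_⟩, hT.card_eq⟩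
        exact card_le_one.1 (hG.card_inter_le_one hA hT.1 hTA) x (by grind) y (by grind)
    have h4 : #(A.powersetCard 3) = 4 := by simp [hA.card_eq]
    have := (card_le_card hsub).trans (card_union_le _ _)
    lia
  · rw [CliqueFree] at hK'
    push Not at hK'
    obtain ⟨B, hB⟩ := hK'
    refine hG.card_cliqueFinset_three_le_of_two_cliques hcard hA
      (hB.mono hle) ?_
    rintro rfl
    obtain ⟨x, hx, y, hy, hxy⟩ := one_lt_card.1 (show 1 < #A by rw [hA.card_eq]; simp)
    exact (hB.1 hx hy hxy).2 ⟨hx, hy⟩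

end

end SimpleGraph

/-- Every `9`-vertex graph with at least `11` triangles contains `P̂₄` as a subgraph. -/
theorem stmt_7 {V : Type} [Fintype V] (G : SimpleGraph V)
    (hcard : Fintype.card V = 9) (ht : 11 ≤ triangleCount G) :
    Contains hatP4 G := by
  classical
  by_contra h
  have := (SimpleGraph.fanFree_of_not_contains h).card_cliqueFinset_three_le hcard
  rw [triangleCount, ← SimpleGraph.coe_cliqueFinset, Set.ncard_coe_finset] at ht
  lia
end

section
/- Every 11-vertex graph with at least 16 triangles contains a subgraph isomorphic to the suspension of P4. -/
/-- No vertex has a path on four vertices among its neighbours. -/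
def HatP4Free {V : Type*} (G : SimpleGraph V) : Prop :=
  ∀ x p q r s, G.Adj x p → G.Adj x q → G.Adj x r → G.Adj x s →
    G.Adj p q → G.Adj q r → G.Adj r s → p ≠ r → p ≠ s → q ≠ s → False

theorem hatP4Free_of_not_contains {V : Type*} {G : SimpleGraph V} (h : ¬ Contains hatP4 G) :
    HatP4Free G := by
  intro x p q r s hp hq hr hs hpq hqr hrs hpr hps hqs
  refine h ⟨fun o => o.elim x ![p, q, r, s], ?_, ?_⟩
  · have := hp.ne
    have := hq.ne
    have := hr.ne
    have := hs.ne
    have := hpq.ne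
    have := hqr.ne
    have := hrs.ne
    intro a b hab
    rcases a with _ | a <;> rcases b with _ | b
    · rfl
    · fin_cases b <;> simp_all
    · fin_cases a <;> simp_all
    · fin_cases a <;> fin_cases b <;> simp_all
  · intro a b hab
    rw [hatP4, SimpleGraph.fromRel_adj] at hab
    have := hp.symm
    have := hq.symm
    have := hr.symm
    have := hs.symm
    have := hpq.symm
    have := hqr.symm
    have := hrs.symm
    rcases a with _ | a <;> rcases b with _ | b
    · simp at hab
    · fin_cases b <;> simpa
    · fin_cases a <;> simpa
    · fin_cases a <;> fin_cases b <;> simp_all [SimpleGraph.pathGraph_adj]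

section Counting

open Finset
open scoped Classical

variable {V : Type*} {G : SimpleGraph V}

theorem HatP4Free.eq_of_adj_fourClique (h : HatP4Free G) {Q : Finset V} (hQ : G.IsNClique 4 Q)
    {v a b : V} (hv : v ∉ Q) (ha : a ∈ Q) (hb : b ∈ Q) (hva : G.Adj v a) (hvb : G.Adj v b) :
    a = b := by
  by_contra hab
  have hcard : #((Q.erase a).erase b) = 2 := by
    rw [card_erase_of_mem (mem_erase.2 ⟨Ne.symm hab, hb⟩), card_erase_of_mem ha, hQ.card_eq]
  obtain ⟨c, d, hcd, he⟩ := card_eq_two.1 hcard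
  have hc : c ∈ (Q.erase a).erase b := by simp [he]
  have hd : d ∈ (Q.erase a).erase b := by simp [he]
  simp only [mem_erase] at hc hd
  have key : ∀ {x y}, x ∈ Q → y ∈ Q → x ≠ y → G.Adj x y := fun hx hy hxy => hQ.isClique hx hy hxy
  refine h a v b c d hva.symm (key ha hb hab) (key ha hc.2.2 (Ne.symm hc.2.1))
    (key ha hd.2.2 (Ne.symm hd.2.1)) hvb (key hb hc.2.2 (Ne.symm hc.1)) (key hc.2.2 hd.2.2 hcd)
    ?_ ?_ (Ne.symm hd.1)
  · rintro rfl; exact hv hc.2.2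
  · rintro rfl; exact hv hd.2.2

theorem HatP4Free.eq_of_mem_fourCliques (h : HatP4Free G) {P Q : Finset V}
    (hP : G.IsNClique 4 P) (hQ : G.IsNClique 4 Q) (hPQ : P ≠ Q) {a b : V}
    (haP : a ∈ P) (haQ : a ∈ Q) (hbP : b ∈ P) (hbQ : b ∈ Q) : a = b := by
  obtain ⟨v, hvP, hvQ⟩ : ∃ v ∈ P, v ∉ Q := by
    by_contra! hsub
    exact hPQ (eq_of_subset_of_card_le hsub (by rw [hP.card_eq, hQ.card_eq]))
  refine h.eq_of_adj_fourClique hQ hvQ haQ hbQ (hP.isClique hvP haP ?_) (hP.isClique hvP hbP ?_)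
  · rintro rfl; exact hvQ haQ
  · rintro rfl; exact hvQ hbQ

theorem HatP4Free.card_inter_le_one (h : HatP4Free G) {P Q : Finset V} (hP : G.IsNClique 4 P)
    (hQ : G.IsNClique 4 Q) (hPQ : P ≠ Q) : #(P ∩ Q) ≤ 1 := by
  refine card_le_one.2 fun a ha b hb => ?_
  rw [mem_inter] at ha hb
  exact h.eq_of_mem_fourCliques hP hQ hPQ ha.1 ha.2 hb.1 hb.2

/-- A triangle in no 4-clique has a vertex whose two edges lie in no other triangle. -/
theorem HatP4Free.exists_apex (h : HatP4Free G) {T : Finset V} (hT : G.IsNClique 3 T)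
    (hTQ : ∀ Q, G.IsNClique 4 Q → ¬ T ⊆ Q) :
    ∃ c ∈ T, ∀ u ∈ T, ∀ w, G.Adj c u → G.Adj c w → G.Adj u w → w ∈ T := by
  have two : ∀ x y z w w', G.Adj x y → G.Adj x z → G.Adj y z → T = {x, y, z} →
      G.Adj x w → G.Adj y w → w ∉ T → G.Adj x w' → G.Adj z w' → w' ∉ T → False := by
    intro x y z w w' hxy hxz hyz hTe hxw hyw hw hxw' hzw' hw'
    subst hTe
    by_cases hww : w = w'
    · subst hww
      refine hTQ (insert w {x, y, z}) ?_ (subset_insert _ _)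
      refine hT.insert ?_
      intro b hb
      simp only [mem_insert, mem_singleton] at hb
      rcases hb with rfl | rfl | rfl
      exacts [hxw.symm, hyw.symm, hzw'.symm]
    · simp only [mem_insert, mem_singleton, not_or] at hw hw'
      exact h x w y z w' hxw hxy hxz hxw' hyw.symm hyz hzw' hw.2.2 hww (Ne.symm hw'.2.1)
  obtain ⟨x, y, z, hxy, hxz, hyz, rfl⟩ := SimpleGraph.is3Clique_iff.1 hT
  have e1 : ({x, y, z} : Finset V) = {y, x, z} := by ext; simp; tauto
  have e2 : ({x, y, z} : Finset V) = {z, x, y} := by ext; simp; tauto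
  let C : V → V → Prop := fun a b => ∃ w, G.Adj a w ∧ G.Adj b w ∧ w ∉ ({x, y, z} : Finset V)
  have hC : ∀ a b, C a b → C b a := fun a b ⟨w, ha, hb, hw⟩ => ⟨w, hb, ha, hw⟩
  have tx : C x y → C x z → False := fun ⟨w, h1, h2, h3⟩ ⟨w', h4, h5, h6⟩ =>
    two x y z w w' hxy hxz hyz rfl h1 h2 h3 h4 h5 h6
  have ty : C y x → C y z → False := fun ⟨w, h1, h2, h3⟩ ⟨w', h4, h5, h6⟩ =>
    two y x z w w' hxy.symm hyz hxz e1 h1 h2 h3 h4 h5 h6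
  have tz : C z x → C z y → False := fun ⟨w, h1, h2, h3⟩ ⟨w', h4, h5, h6⟩ =>
    two z x y w w' hxz.symm hyz.symm hxy e2 h1 h2 h3 h4 h5 h6
  by_contra! hcon
  have hbad : ∀ a ∈ ({x, y, z} : Finset V),
      (a ≠ x ∧ C a x) ∨ (a ≠ y ∧ C a y) ∨ (a ≠ z ∧ C a z) := by
    intro a ha
    obtain ⟨u, hu, w, hau, haw, huw, hw⟩ := hcon a ha
    simp only [mem_insert, mem_singleton] at hu
    rcases hu with rfl | rfl | rfl
    exacts [Or.inl ⟨hau.ne, w, haw, huw, hw⟩, Or.inr (Or.inl ⟨hau.ne, w, haw, huw, hw⟩),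
      Or.inr (Or.inr ⟨hau.ne, w, haw, huw, hw⟩)]
  have bad_x : C x y ∨ C x z := by
    rcases hbad x (by simp) with h | h | h
    exacts [(h.1 rfl).elim, Or.inl h.2, Or.inr h.2]
  have bad_y : C y x ∨ C y z := by
    rcases hbad y (by simp) with h | h | h
    exacts [Or.inl h.2, (h.1 rfl).elim, Or.inr h.2]
  have bad_z : C z x ∨ C z y := by
    rcases hbad z (by simp) with h | h | h
    exacts [Or.inl h.2, Or.inr h.2, (h.1 rfl).elim]
  rcases bad_x with h | h
  · exact bad_z.elim (fun h' => tx h (hC z x h')) (fun h' => ty (hC x y h) (hC z y h'))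
  · exact bad_y.elim (fun h' => tx (hC y x h') h) (fun h' => tz (hC x z h) (hC y z h'))

/-- The ordered pairs joining `c` to the other vertices of `T`. -/
noncomputable def apexPairs (T : Finset V) (c : V) : Finset (V × V) :=
  {c} ×ˢ T.erase c ∪ T.erase c ×ˢ {c}

theorem mem_apexPairs {T : Finset V} {c a b : V} :
    (a, b) ∈ apexPairs T c ↔ (a = c ∧ b ≠ c ∧ b ∈ T) ∨ (b = c ∧ a ≠ c ∧ a ∈ T) := by
  simp only [apexPairs, mem_union, mem_product, mem_singleton, mem_erase]
  tauto

theorem card_apexPairs {T : Finset V} {c : V} (hT : #T = 3) (hc : c ∈ T) :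
    #(apexPairs T c) = 4 := by
  rw [apexPairs, card_union_of_disjoint, card_product, card_product, card_singleton,
    card_erase_of_mem hc, hT]
  rw [disjoint_left]
  rintro ⟨a, b⟩ h1 h2
  simp only [mem_product, mem_singleton, mem_erase] at h1 h2
  exact h1.2.1 h2.2

/-- Mantel's theorem inside a set of vertices. -/
theorem two_mul_card_interedges_le {H : SimpleGraph V} (hH : H.CliqueFree 3) (S : Finset V) :
    2 * #(H.interedges S S) ≤ #S ^ 2 := by
  set d : V → ℕ := fun a => #{b ∈ S | H.Adj a b} with hd
  have hp : #(H.interedges S S) = ∑ a ∈ S, d a := by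
    simp only [SimpleGraph.interedges_def, card_filter, sum_product, hd]
  have hadj : ∀ a ∈ S, ∀ b ∈ S, (if H.Adj a b then d a + d b else 0) ≤
      if H.Adj a b then #S else 0 := by
    intro a _ b _
    split_ifs with hab
    · rw [hd, ← card_union_of_disjoint]
      · exact card_le_card (union_subset (filter_subset _ _) (filter_subset _ _))
      · rw [disjoint_left]
        intro c hc hc'
        exact hH _ (SimpleGraph.is3Clique_triple_iff.2
          ⟨hab, (mem_filter.1 hc).2, (mem_filter.1 hc').2⟩)
    · rfl
  have hsum := sum_le_sum fun a ha => sum_le_sum (hadj a ha)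
  have hl : ∑ a ∈ S, ∑ b ∈ S, (if H.Adj a b then d a + d b else 0) = 2 * ∑ a ∈ S, d a ^ 2 := by
    have e1 : ∑ a ∈ S, ∑ b ∈ S, (if H.Adj a b then d a else 0) = ∑ a ∈ S, d a ^ 2 := by
      refine sum_congr rfl fun a _ => ?_
      rw [← sum_filter, sum_const, smul_eq_mul, sq]
    have e2 : ∑ a ∈ S, ∑ b ∈ S, (if H.Adj a b then d b else 0) = ∑ a ∈ S, d a ^ 2 := by
      rw [sum_comm, ← e1]
      simp only [H.adj_comm]
    rw [two_mul]
    nth_rw 1 [← e1]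
    rw [← e2, ← sum_add_distrib]
    refine sum_congr rfl fun a _ => ?_
    rw [← sum_add_distrib]
    exact sum_congr rfl fun b _ => by split_ifs <;> rfl
  have hr : ∑ a ∈ S, ∑ b ∈ S, (if H.Adj a b then #S else 0) = #S * ∑ a ∈ S, d a := by
    rw [mul_sum]
    refine sum_congr rfl fun a _ => ?_
    rw [← sum_filter, sum_const, smul_eq_mul, mul_comm]
  rw [hl, hr] at hsum
  have hcs := sq_sum_le_card_mul_sum_sq (s := S) (f := d)
  rw [hp]
  set p := ∑ a ∈ S, d a
  rcases Nat.eq_zero_or_pos p with h0 | hpos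
  · simp [h0]
  · refine Nat.le_of_mul_le_mul_right ?_ hpos
    nlinarith

theorem card_interedges_union_le (H : SimpleGraph V) (S T : Finset V) :
    #(H.interedges (S ∪ T) (S ∪ T)) ≤
      #(H.interedges S S) + 2 * #(H.interedges T S) + #(H.interedges T T) := by
  have hsub : H.interedges (S ∪ T) (S ∪ T) ⊆
      (H.interedges S S ∪ H.interedges S T) ∪ (H.interedges T S ∪ H.interedges T T) := by
    rintro ⟨a, b⟩ hab
    simp only [mem_union, SimpleGraph.mk_mem_interedges_iff] at hab ⊢
    tauto
  have h1 := card_le_card hsub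
  have h2 := card_union_le (H.interedges S S ∪ H.interedges S T)
    (H.interedges T S ∪ H.interedges T T)
  have h3 := card_union_le (H.interedges S S) (H.interedges S T)
  have h4 := card_union_le (H.interedges T S) (H.interedges T T)
  have : Std.Symm H.Adj := ⟨fun _ _ h => h.symm⟩
  have h5 : #(H.interedges S T) = #(H.interedges T S) := Rel.card_interedges_comm S T
  omega

theorem card_interedges_le_card (H : SimpleGraph V) {S T : Finset V}
    (h : ∀ v ∈ T, ∀ a ∈ S, ∀ b ∈ S, H.Adj v a → H.Adj v b → a = b) :
    #(H.interedges T S) ≤ #T := by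
  refine card_le_card_of_injOn Prod.fst ?_ ?_
  · rintro ⟨a, b⟩ hab
    exact ((SimpleGraph.mk_mem_interedges_iff _).1 hab).1
  · rintro ⟨a, b⟩ hab ⟨a', b'⟩ hab' (rfl : a = a')
    obtain ⟨h1, h2, h3⟩ := (SimpleGraph.mk_mem_interedges_iff _).1 hab
    obtain ⟨_, h2', h3'⟩ := (H.mk_mem_interedges_iff).1 hab'
    rw [h a h1 b h2 b' h2' h3 h3']

theorem card_interedges_self_le (H : SimpleGraph V) (S : Finset V) :
    #(H.interedges S S) ≤ #S * #S - #S := by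
  rw [← offDiag_card]
  refine card_le_card ?_
  rintro ⟨a, b⟩ hab
  obtain ⟨h1, h2, h3⟩ := (SimpleGraph.mk_mem_interedges_iff _).1 hab
  exact mem_offDiag.2 ⟨h1, h2, h3.ne⟩

variable [Fintype V]

/-- The triangles that lie in no 4-clique. -/
noncomputable def isolatedTriangles (G : SimpleGraph V) : Finset (Finset V) :=
  {T ∈ G.cliqueFinset 3 | ∀ Q, G.IsNClique 4 Q → ¬ T ⊆ Q}

theorem card_triangles_le (G : SimpleGraph V) :
    #(G.cliqueFinset 3) ≤ #(isolatedTriangles G) + 4 * #(G.cliqueFinset 4) := by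
  have hsub : G.cliqueFinset 3 ⊆
      isolatedTriangles G ∪ (G.cliqueFinset 4).biUnion fun Q => Q.powersetCard 3 := by
    intro T hT
    rw [mem_union, isolatedTriangles, mem_filter, mem_biUnion]
    by_cases h : ∀ Q, G.IsNClique 4 Q → ¬ T ⊆ Q
    · exact Or.inl ⟨hT, h⟩
    · push Not at h
      obtain ⟨Q, hQ, hTQ⟩ := h
      exact Or.inr ⟨Q, G.mem_cliqueFinset_iff.2 hQ,
        mem_powersetCard.2 ⟨hTQ, (G.mem_cliqueFinset_iff.1 hT).card_eq⟩⟩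
  have h1 := card_le_card hsub
  have h2 := card_union_le (isolatedTriangles G)
    ((G.cliqueFinset 4).biUnion fun Q => Q.powersetCard 3)
  have h3 : #((G.cliqueFinset 4).biUnion fun Q => Q.powersetCard 3) ≤ #(G.cliqueFinset 4) * 4 := by
    refine card_biUnion_le_card_mul _ _ _ fun Q hQ => ?_
    rw [card_powersetCard, (G.mem_cliqueFinset_iff.1 hQ).card_eq]
    rfl
  omega

/-- Two private edges of every triangle outside the 4-cliques form a triangle-free graph. -/
theorem HatP4Free.exists_triangleFree [Nonempty V] (h : HatP4Free G) :
    ∃ H : SimpleGraph V, H.CliqueFree 3 ∧ H ≤ G ∧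
      (∀ Q, G.IsNClique 4 Q → ∀ a ∈ Q, ∀ b ∈ Q, ¬ H.Adj a b) ∧
      4 * #(isolatedTriangles G) ≤ #(H.interedges univ univ) := by
  have hN : ∀ T ∈ isolatedTriangles G, G.IsNClique 3 T ∧ ∀ Q, G.IsNClique 4 Q → ¬ T ⊆ Q := by
    intro T hT
    rw [isolatedTriangles, mem_filter, G.mem_cliqueFinset_iff] at hT
    exact hT
  choose! c hcT hc using fun T hT => h.exists_apex (hN T hT).1 (hN T hT).2
  have hadj : ∀ T ∈ isolatedTriangles G, ∀ a b, (a, b) ∈ apexPairs T (c T) →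
      a ∈ T ∧ b ∈ T ∧ G.Adj a b ∧ ∀ w, G.Adj a w → G.Adj b w → w ∈ T := by
    intro T hT a b hab
    have hcl := (hN T hT).1.isClique
    rcases mem_apexPairs.1 hab with ⟨rfl, hb, hbT⟩ | ⟨rfl, ha, haT⟩
    · have := hcl (hcT T hT) hbT (Ne.symm hb)
      exact ⟨hcT T hT, hbT, this, fun w h1 h2 => hc T hT b hbT w this h1 h2⟩
    · have := hcl (hcT T hT) haT (Ne.symm ha)
      exact ⟨haT, hcT T hT, this.symm, fun w h1 h2 => hc T hT a haT w this h2 h1⟩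
  have huniq : ∀ T ∈ isolatedTriangles G, ∀ T' : Finset V, G.IsNClique 3 T' → ∀ a b,
      (a, b) ∈ apexPairs T (c T) → a ∈ T' → b ∈ T' → T' = T := by
    intro T hT T' hT' a b hab ha hb
    obtain ⟨haT, hbT, hG, hw⟩ := hadj T hT a b hab
    refine eq_of_subset_of_card_le (fun w hwT => ?_)
      (by rw [(hN T hT).1.card_eq, hT'.card_eq])
    by_cases hwa : a = w
    · exact hwa ▸ haT
    by_cases hwb : b = w
    · exact hwb ▸ hbT
    exact hw w (hT'.isClique ha hwT hwa) (hT'.isClique hb hwT hwb)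
  obtain ⟨H, hH⟩ : ∃ H : SimpleGraph V, ∀ a b,
      H.Adj a b ↔ ∃ T ∈ isolatedTriangles G, (a, b) ∈ apexPairs T (c T) :=
    ⟨{ Adj := fun a b => ∃ T ∈ isolatedTriangles G, (a, b) ∈ apexPairs T (c T)
       symm := ⟨fun a b ⟨T, hT, hab⟩ => ⟨T, hT, mem_apexPairs.2 (mem_apexPairs.1 hab).symm⟩⟩
       loopless := ⟨fun a ⟨T, hT, ha⟩ => (hadj T hT a a ha).2.2.1.ne rfl⟩ }, fun _ _ => Iff.rfl⟩
  have hHG : H ≤ G := fun a b h => by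
    obtain ⟨T, hT, hab⟩ := (hH a b).1 h
    exact (hadj T hT a b hab).2.2.1
  refine ⟨H, ?_, hHG, ?_, ?_⟩
  · intro S hS
    obtain ⟨x, y, z, hxy, hxz, hyz, rfl⟩ := SimpleGraph.is3Clique_iff.1 hS
    have hS' : G.IsNClique 3 {x, y, z} := hS.mono hHG
    obtain ⟨T, hT, h1⟩ := (hH _ _).1 hxy
    obtain ⟨T₂, hT₂, h2⟩ := (hH _ _).1 hxz
    obtain ⟨T₃, hT₃, h3⟩ := (hH _ _).1 hyz
    obtain rfl := huniq T hT _ hS' x y h1 (by simp) (by simp)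
    obtain rfl := huniq T₂ hT₂ _ hS' x z h2 (by simp) (by simp)
    obtain rfl := huniq T₃ hT₃ _ hS' y z h3 (by simp) (by simp)
    rw [mem_apexPairs] at h1 h2 h3
    grind
  · intro Q hQ a ha b hb h
    obtain ⟨T, hT, hab⟩ := (hH a b).1 h
    obtain ⟨haT, hbT, hG, hw⟩ := hadj T hT a b hab
    have hsub : Q ⊆ T := by
      intro w hwQ
      by_cases hwa : a = w
      · exact hwa ▸ haT
      by_cases hwb : b = w
      · exact hwb ▸ hbT
      exact hw w (hQ.isClique ha hwQ hwa) (hQ.isClique hb hwQ hwb)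
    have := card_le_card hsub
    rw [hQ.card_eq, (hN T hT).1.card_eq] at this
    omega
  · have hdisj : (isolatedTriangles G : Set (Finset V)).PairwiseDisjoint
        fun T => apexPairs T (c T) := by
      intro T hT T' hT' hne
      rw [Function.onFun, disjoint_left]
      rintro ⟨a, b⟩ h1 h2
      obtain ⟨haT, hbT, -, -⟩ := hadj T hT a b h1
      exact hne (huniq T' hT' T (hN T hT).1 a b h2 haT hbT)
    rw [mul_comm, ← sum_const_nat fun T hT => card_apexPairs (hN T hT).1.card_eq (hcT T hT),
      ← card_biUnion hdisj]
    refine card_le_card ?_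
    rintro ⟨a, b⟩ hab
    exact (SimpleGraph.mk_mem_interedges_iff _).2 ⟨mem_univ _, mem_univ _,
      (hH a b).2 (mem_biUnion.1 hab)⟩

theorem HatP4Free.card_interedges_add_le (h : HatP4Free G) {H : SimpleGraph V} (hHG : H ≤ G)
    (hH : ∀ Q, G.IsNClique 4 Q → ∀ a ∈ Q, ∀ b ∈ Q, ¬ H.Adj a b) :
    #(H.interedges univ univ) + 12 * #(G.cliqueFinset 4) ≤ #(G.interedges univ univ) := by
  have hdisj : (G.cliqueFinset 4 : Set (Finset V)).PairwiseDisjoint offDiag := by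
    intro P hP Q hQ hne
    rw [Function.onFun, disjoint_left]
    rintro ⟨a, b⟩ h1 h2
    rw [mem_offDiag] at h1 h2
    exact h1.2.2 (h.eq_of_mem_fourCliques (G.mem_cliqueFinset_iff.1 hP)
      (G.mem_cliqueFinset_iff.1 hQ) hne h1.1 h2.1 h1.2.1 h2.2.1)
  have hc : ∀ Q ∈ G.cliqueFinset 4, #Q.offDiag = 12 := by
    intro Q hQ
    rw [offDiag_card, (G.mem_cliqueFinset_iff.1 hQ).card_eq]
  rw [mul_comm, ← sum_const_nat hc, ← card_biUnion hdisj, ← card_union_of_disjoint]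
  · refine card_le_card (union_subset ?_ ?_)
    · rintro ⟨a, b⟩ hab
      rw [SimpleGraph.mk_mem_interedges_iff] at hab ⊢
      exact ⟨hab.1, hab.2.1, hHG hab.2.2⟩
    · rintro ⟨a, b⟩ hab
      obtain ⟨Q, hQ, h1⟩ := mem_biUnion.1 hab
      rw [mem_offDiag] at h1
      exact (SimpleGraph.mk_mem_interedges_iff _).2 ⟨mem_univ _, mem_univ _,
        (G.mem_cliqueFinset_iff.1 hQ).isClique h1.1 h1.2.1 h1.2.2⟩
  · rw [disjoint_left]
    rintro ⟨a, b⟩ h1 h2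
    obtain ⟨Q, hQ, h3⟩ := mem_biUnion.1 h2
    rw [mem_offDiag] at h3
    exact hH Q (G.mem_cliqueFinset_iff.1 hQ) a h3.1 b h3.2.1
      ((SimpleGraph.mk_mem_interedges_iff _).1 h1).2.2

theorem HatP4Free.card_interedges_le_of_disjoint (h : HatP4Free G) (hV : Fintype.card V = 11)
    {A B : Finset V} (hA : G.IsNClique 4 A) (hB : G.IsNClique 4 B) (hAB : Disjoint A B) :
    #(G.interedges univ univ) ≤ 50 := by
  have hcB := hB.card_eq
  have hcA := hA.card_eq
  have hcC : #(A ∪ B)ᶜ = 3 := by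
    rw [card_compl, card_union_of_disjoint hAB, hV, hcA, hcB]
  have hu : (univ : Finset V) = A ∪ (B ∪ (A ∪ B)ᶜ) := by
    ext v; simp; tauto
  have h1 := card_interedges_union_le G A (B ∪ (A ∪ B)ᶜ)
  have h2 := card_interedges_union_le G B (A ∪ B)ᶜ
  have h3 := card_interedges_self_le G A
  have h4 := card_interedges_self_le G B
  have h5 := card_interedges_self_le G (A ∪ B)ᶜ
  have h6 : #(G.interedges (B ∪ (A ∪ B)ᶜ) A) ≤ _ :=
    card_interedges_le_card G fun v hv a ha b hb => h.eq_of_adj_fourClique hA (by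
      intro hvA
      rcases mem_union.1 hv with hv | hv
      · exact disjoint_left.1 hAB hvA hv
      · simp [hvA] at hv) ha hb
  have h7 : #(G.interedges (A ∪ B)ᶜ B) ≤ _ :=
    card_interedges_le_card G fun v hv a ha b hb => h.eq_of_adj_fourClique hB (by
      intro hvB
      simp [hvB] at hv) ha hb
  have h8 := card_union_le B (A ∪ B)ᶜ
  rw [hu]
  rw [hcA] at h3
  rw [hcB] at h4 h8
  rw [hcC] at h5 h7 h8
  omega

/-- Two disjoint 4-cliques leave room for at most one more. -/
theorem HatP4Free.card_fourCliques_le_of_disjoint (h : HatP4Free G) (hV : Fintype.card V = 11)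
    {A B : Finset V} (hA : G.IsNClique 4 A) (hB : G.IsNClique 4 B) (hAB : Disjoint A B) :
    #(G.cliqueFinset 4) ≤ 3 := by
  by_contra! hk
  have hcC : #(A ∪ B)ᶜ = 3 := by
    rw [card_compl, card_union_of_disjoint hAB, hV, hA.card_eq, hB.card_eq]
  have h2 : 1 < #(((G.cliqueFinset 4).erase A).erase B) := by
    have := pred_card_le_card_erase (s := G.cliqueFinset 4) (a := A)
    have := pred_card_le_card_erase (s := (G.cliqueFinset 4).erase A) (a := B)
    omega
  obtain ⟨P, hP, Q, hQ, hPQ⟩ := one_lt_card.1 h2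
  simp only [mem_erase, G.mem_cliqueFinset_iff] at hP hQ
  obtain ⟨hPB, hPA, hP⟩ := hP
  obtain ⟨hQB, hQA, hQ⟩ := hQ
  have split : ∀ R : Finset V, G.IsNClique 4 R →
      #(R ∩ A) + #(R ∩ B) + #(R ∩ (A ∪ B)ᶜ) = 4 := by
    intro R hR
    rw [← hR.card_eq, ← card_union_of_disjoint, ← card_union_of_disjoint]
    · congr 1
      ext v; simp; tauto
    · rw [disjoint_left]
      intro v; simp; tauto
    · exact hAB.mono inter_subset_right inter_subset_right
  have hPs := split P hP
  have hQs := split Q hQ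
  have p1 := h.card_inter_le_one hP hA hPA
  have p2 := h.card_inter_le_one hP hB hPB
  have q1 := h.card_inter_le_one hQ hA hQA
  have q2 := h.card_inter_le_one hQ hB hQB
  have pq := h.card_inter_le_one hP hQ hPQ
  have hie := card_union_add_card_inter (P ∩ (A ∪ B)ᶜ) (Q ∩ (A ∪ B)ᶜ)
  have hun : #(P ∩ (A ∪ B)ᶜ ∪ Q ∩ (A ∪ B)ᶜ) ≤ 3 :=
    hcC ▸ card_le_card (union_subset inter_subset_right inter_subset_right)
  have hin : #(P ∩ (A ∪ B)ᶜ ∩ (Q ∩ (A ∪ B)ᶜ)) ≤ #(P ∩ Q) :=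
    card_le_card (inter_subset_inter inter_subset_left inter_subset_left)
  obtain ⟨c, hc⟩ : (P ∩ (A ∪ B)ᶜ ∩ (Q ∩ (A ∪ B)ᶜ)).Nonempty := card_pos.1 (by omega)
  obtain ⟨a, ha⟩ : (P ∩ A).Nonempty := card_pos.1 (by omega)
  obtain ⟨b, hb⟩ : (Q ∩ A).Nonempty := card_pos.1 (by omega)
  simp only [mem_inter, mem_compl, mem_union, not_or] at ha hb hc
  obtain ⟨⟨hcP, hcA, -⟩, hcQ, -, -⟩ := hc
  have hca : c ≠ a := fun e => hcA (e ▸ ha.2)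
  have hcb : c ≠ b := fun e => hcA (e ▸ hb.2)
  have hab := h.eq_of_adj_fourClique hA hcA ha.2 hb.2 (hP.isClique hcP ha.1 hca)
    (hQ.isClique hcQ hb.1 hcb)
  exact hca (h.eq_of_mem_fourCliques hP hQ hPQ hcP hcQ ha.1 (hab ▸ hb.1))

theorem HatP4Free.card_interedges_le_of_inter (h : HatP4Free G) (hV : Fintype.card V = 11)
    {A B : Finset V} (hA : G.IsNClique 4 A) (hB : G.IsNClique 4 B) (hAB : A ≠ B) {x : V}
    (hxA : x ∈ A) (hxB : x ∈ B) :
    #(G.interedges univ univ) ≤ 44 + 2 * #(G.interedges (A ∪ B)ᶜ (B.erase x)) := by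
  have hcA := hA.card_eq
  have hcB : #(B.erase x) = 3 := by rw [card_erase_of_mem hxB, hB.card_eq]
  have hdisj : ∀ v ∈ B.erase x, v ∉ A := fun v hv hvA =>
    (mem_erase.1 hv).1 (h.eq_of_mem_fourCliques hA hB hAB hvA (mem_erase.1 hv).2 hxA hxB)
  have hun : A ∪ B.erase x = A ∪ B := by
    ext v
    simp only [mem_union, mem_erase]
    refine ⟨by tauto, fun hv => ?_⟩
    by_cases hvx : v = x
    · exact Or.inl (hvx ▸ hxA)
    · tauto
  have hcW : #(A ∪ B)ᶜ = 4 := by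
    rw [card_compl, ← hun, card_union_of_disjoint (disjoint_right.2 hdisj), hV, hcA, hcB]
  have hu : (univ : Finset V) = A ∪ (B.erase x ∪ (A ∪ B)ᶜ) := by
    rw [← union_assoc, hun, union_compl]
  have h1 := card_interedges_union_le G A (B.erase x ∪ (A ∪ B)ᶜ)
  have h2 := card_interedges_union_le G (B.erase x) (A ∪ B)ᶜ
  have h3 := card_interedges_self_le G A
  have h4 := card_interedges_self_le G (B.erase x)
  have h5 := card_interedges_self_le G (A ∪ B)ᶜ
  have h6 : #(G.interedges (B.erase x ∪ (A ∪ B)ᶜ) A) ≤ _ :=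
    card_interedges_le_card G fun v hv a ha b hb => h.eq_of_adj_fourClique hA (by
      rcases mem_union.1 hv with hv | hv
      · exact hdisj v hv
      · intro hvA
        simp [hvA] at hv) ha hb
  have h8 := card_union_le (B.erase x) (A ∪ B)ᶜ
  rw [hu]
  rw [hcA] at h3
  rw [hcB] at h4 h8
  rw [hcW] at h5 h8
  omega

theorem HatP4Free.card_compl_union_le (h : HatP4Free G) (hV : Fintype.card V = 11)
    {A B : Finset V} (hA : G.IsNClique 4 A) (hB : G.IsNClique 4 B) (hAB : A ≠ B) :
    #(A ∪ B)ᶜ ≤ 4 := by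
  have h1 := h.card_inter_le_one hA hB hAB
  have h2 := card_union_add_card_inter A B
  rw [hA.card_eq, hB.card_eq] at h2
  rw [card_compl, hV]
  omega

/-- A third 4-clique through `x` sends no edge to `B.erase x`. -/
theorem HatP4Free.card_interedges_le_one (h : HatP4Free G) (hV : Fintype.card V = 11)
    {A B D : Finset V} (hA : G.IsNClique 4 A) (hB : G.IsNClique 4 B) (hD : G.IsNClique 4 D)
    (hAB : A ≠ B) (hDA : D ≠ A) (hDB : D ≠ B) {x : V} (hxA : x ∈ A) (hxB : x ∈ B)
    (hxD : x ∈ D) : #(G.interedges (A ∪ B)ᶜ (B.erase x)) ≤ 1 := by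
  have hsub : G.interedges (A ∪ B)ᶜ (B.erase x) ⊆
      G.interedges ((A ∪ B)ᶜ \ D.erase x) (B.erase x) := by
    rintro ⟨v, b⟩ hvb
    obtain ⟨hv, hb, hadj⟩ := (G.mk_mem_interedges_iff).1 hvb
    refine (G.mk_mem_interedges_iff).2 ⟨mem_sdiff.2 ⟨hv, fun hvD => ?_⟩, hb, hadj⟩
    rw [mem_erase] at hvD hb
    have hvB : v ∉ B := fun hvB => by simp [hvB] at hv
    exact hb.1 (h.eq_of_adj_fourClique hB hvB hb.2 hxB hadj (hD.isClique hvD.2 hxD hvD.1))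
  have hDW : D.erase x ⊆ (A ∪ B)ᶜ := by
    intro v hv
    rw [mem_erase] at hv
    rw [mem_compl, mem_union, not_or]
    exact ⟨fun hvA => hv.1 (h.eq_of_mem_fourCliques hD hA hDA hv.2 hvA hxD hxA),
      fun hvB => hv.1 (h.eq_of_mem_fourCliques hD hB hDB hv.2 hvB hxD hxB)⟩
  have h1 : #(G.interedges ((A ∪ B)ᶜ \ D.erase x) (B.erase x)) ≤ _ :=
    card_interedges_le_card G fun v hv a ha b hb => h.eq_of_adj_fourClique hB
      (fun hvB => by simp [hvB] at hv) (mem_of_mem_erase ha) (mem_of_mem_erase hb)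
  rw [card_sdiff_of_subset hDW, card_erase_of_mem hxD, hD.card_eq] at h1
  have h2 := h.card_compl_union_le hV hA hB hAB
  have h3 := card_le_card hsub
  omega

theorem HatP4Free.card_cliqueFinset_three_le (h : HatP4Free G) (hV : Fintype.card V = 11) :
    #(G.cliqueFinset 3) ≤ 15 := by
  by_contra! ht
  have : Nonempty V := Fintype.card_pos_iff.1 (by omega)
  obtain ⟨H, hfree, hHG, hHQ, hHcard⟩ := h.exists_triangleFree
  have htri := card_triangles_le G
  have hsum := h.card_interedges_add_le hHG hHQ
  rcases Nat.lt_or_ge 1 #(G.cliqueFinset 4) with hk | hk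
  · obtain ⟨A, hA, B, hB, hAB⟩ := one_lt_card.1 hk
    by_cases hex : ∃ P Q, G.IsNClique 4 P ∧ G.IsNClique 4 Q ∧ Disjoint P Q
    · obtain ⟨P, Q, hP, hQ, hPQ⟩ := hex
      have := h.card_interedges_le_of_disjoint hV hP hQ hPQ
      have := h.card_fourCliques_le_of_disjoint hV hP hQ hPQ
      omega
    · have hmeet : ∀ P Q, G.IsNClique 4 P → G.IsNClique 4 Q → ∃ x, x ∈ P ∧ x ∈ Q := by
        intro P Q hP hQ
        by_contra! hdis
        exact hex ⟨P, Q, hP, hQ, disjoint_left.2 hdis⟩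
      rw [G.mem_cliqueFinset_iff] at hA hB
      obtain ⟨x, hxA, hxB⟩ := hmeet A B hA hB
      have hx := h.card_interedges_le_of_inter hV hA hB hAB hxA hxB
      have hBx : #(G.interedges (A ∪ B)ᶜ (B.erase x)) ≤ _ :=
        card_interedges_le_card G fun v hv a ha b hb => h.eq_of_adj_fourClique hB
          (fun hvB => by simp [hvB] at hv) (mem_of_mem_erase ha) (mem_of_mem_erase hb)
      have hW := h.card_compl_union_le hV hA hB hAB
      have h3 : 0 < #(((G.cliqueFinset 4).erase A).erase B) := by
        have := pred_card_le_card_erase (s := G.cliqueFinset 4) (a := A)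
        have := pred_card_le_card_erase (s := (G.cliqueFinset 4).erase A) (a := B)
        omega
      obtain ⟨D, hD⟩ := card_pos.1 h3
      simp only [mem_erase, G.mem_cliqueFinset_iff] at hD
      obtain ⟨hDB, hDA, hD⟩ := hD
      have hxD : x ∈ D := by
        obtain ⟨y, hyD, hyA⟩ := hmeet D A hD hA
        obtain ⟨z, hzD, hzB⟩ := hmeet D B hD hB
        by_contra hxD
        have hzx : z ≠ x := fun e => hxD (e ▸ hzD)
        have hzA : z ∉ A := fun hzA => hzx (h.eq_of_mem_fourCliques hA hB hAB hzA hzB hxA hxB)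
        have hzy : z ≠ y := fun e => hzA (e ▸ hyA)
        exact hxD (h.eq_of_adj_fourClique hA hzA hxA hyA (hB.isClique hzB hxB hzx)
          (hD.isClique hzD hyD hzy) ▸ hyD)
      have := h.card_interedges_le_one hV hA hB hD hAB hDA hDB hxA hxB hxD
      omega
  · rcases Nat.eq_zero_or_pos #(G.cliqueFinset 4) with h0 | hpos
    · have := two_mul_card_interedges_le hfree univ
      rw [card_univ, hV] at this
      omega
    · obtain ⟨A, hA⟩ := card_pos.1 hpos
      rw [G.mem_cliqueFinset_iff] at hA
      have h1 := card_interedges_union_le H A Aᶜ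
      have h2 := two_mul_card_interedges_le hfree Aᶜ
      have h3 : #(H.interedges Aᶜ A) ≤ _ :=
        card_interedges_le_card H fun v hv a ha b hb hva hvb =>
          h.eq_of_adj_fourClique hA (mem_compl.1 hv) ha hb (hHG hva) (hHG hvb)
      have h4 : H.interedges A A = ∅ := by
        rw [eq_empty_iff_forall_notMem]
        rintro ⟨a, b⟩ hab
        obtain ⟨ha, hb, hadj⟩ := (H.mk_mem_interedges_iff).1 hab
        exact hHQ A hA a ha b hb hadj
      rw [h4, card_empty, union_compl] at h1
      rw [card_compl, hA.card_eq, hV] at h2 h3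
      omega

end Counting

/-- Every `11`-vertex graph with at least `16` triangles contains `P̂₄` as a subgraph. -/
theorem stmt_9 {V : Type} [Fintype V] (G : SimpleGraph V)
    (hcard : Fintype.card V = 11) (ht : 16 ≤ triangleCount G) :
    Contains hatP4 G := by
  classical
  by_contra hcon
  have h := (hatP4Free_of_not_contains hcon).card_cliqueFinset_three_le hcard
  rw [← Set.ncard_coe_finset, SimpleGraph.coe_cliqueFinset] at h
  exact absurd (ht.trans h) (by norm_num)
end

section
/- If G is an n-vertex graph that is P̂₄-free and contains no K₄ (complete graph on 4 vertices) as a subgraph, then the number of triangles in G is at most ⌊n²/8⌋. -/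
/-- The adjacency patterns of two distinct triangles hanging on two edges at a common vertex of a
third triangle produce either `P̂₄` or `K₄`. -/
theorem false_of_fan {V : Type*} {G : SimpleGraph V}
    (hP4 : ¬ Contains hatP4 G) (hK4 : ¬ Contains (⊤ : SimpleGraph (Fin 4)) G)
    {v x y a d : V} (hvx : G.Adj v x) (hvy : G.Adj v y) (hxy : G.Adj x y)
    (hva : G.Adj v a) (hxa : G.Adj x a) (hay : a ≠ y)
    (hvd : G.Adj v d) (hyd : G.Adj y d) (hdx : d ≠ x) : False := by
  have hvx' := hvx.ne
  have hvy' := hvy.ne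
  have hxy' := hxy.ne
  have hva' := hva.ne
  have hxa' := hxa.ne
  have hvd' := hvd.ne
  have hyd' := hyd.ne
  by_cases had : a = d
  · subst had
    refine hK4 ⟨![v, x, y, a], ?_, ?_⟩
    · intro i j h
      fin_cases i <;> fin_cases j <;> simp_all
    · intro i j h
      fin_cases i <;> fin_cases j <;> simp_all [G.adj_comm]
  · refine hP4 ⟨fun o => o.elim v ![a, x, y, d], ?_, ?_⟩
    · rintro (_ | i) (_ | j) h
      · rfl
      · fin_cases j <;> simp_all
      · fin_cases i <;> simp_all
      · fin_cases i <;> fin_cases j <;> simp_all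
    · rintro (_ | i) (_ | j) h
      · simp [hatP4] at h
      · fin_cases j <;> simp_all
      · fin_cases i <;> simp_all [G.adj_comm]
      · fin_cases i <;> fin_cases j <;>
          simp_all [hatP4, SimpleGraph.pathGraph_adj, G.adj_comm]

/-- Two vertices with at most one common neighbour. -/
def IsLight {V : Type*} (G : SimpleGraph V) (u v : V) : Prop :=
  ∀ ⦃z w⦄, G.Adj u z → G.Adj v z → G.Adj u w → G.Adj v w → z = w

theorem IsLight.symm {V : Type*} {G : SimpleGraph V} {u v : V} (h : IsLight G u v) :
    IsLight G v u :=
  fun _ _ h₁ h₂ h₃ h₄ => h h₂ h₁ h₄ h₃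

theorem IsLight.eq_of_isNClique {V : Type*} [DecidableEq V] {G : SimpleGraph V} {u v : V}
    (h : IsLight G u v) (huv : u ≠ v) {S T : Finset V} (hS : G.IsNClique 3 S)
    (hT : G.IsNClique 3 T) (huS : u ∈ S) (hvS : v ∈ S) (huT : u ∈ T) (hvT : v ∈ T) : S = T := by
  have key : ∀ {R : Finset V}, G.IsNClique 3 R → u ∈ R → v ∈ R →
      ∃ z, G.Adj u z ∧ G.Adj v z ∧ R = {u, v, z} := by
    intro R hR hu hv
    have hc : ((R.erase u).erase v).card = 1 := by
      rw [Finset.card_erase_of_mem (Finset.mem_erase.2 ⟨huv.symm, hv⟩),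
        Finset.card_erase_of_mem hu, hR.card_eq]
    obtain ⟨z, hz⟩ := Finset.card_eq_one.1 hc
    have hzm : z ∈ (R.erase u).erase v := by simp [hz]
    simp only [Finset.mem_erase] at hzm
    refine ⟨z, hR.isClique hu hzm.2.2 hzm.2.1.symm, hR.isClique hv hzm.2.2 hzm.1.symm, ?_⟩
    rw [← hz, Finset.insert_erase (Finset.mem_erase.2 ⟨huv.symm, hv⟩), Finset.insert_erase hu]
  obtain ⟨z, huz, hvz, rfl⟩ := key hS huS hvS
  obtain ⟨w, huw, hvw, rfl⟩ := key hT huT hvT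
  rw [h huz hvz huw hvw]

theorem isLight_or_isLight {V : Type*} {G : SimpleGraph V}
    (hP4 : ¬ Contains hatP4 G) (hK4 : ¬ Contains (⊤ : SimpleGraph (Fin 4)) G)
    {v x y : V} (hvx : G.Adj v x) (hvy : G.Adj v y) (hxy : G.Adj x y) :
    IsLight G v x ∨ IsLight G v y := by
  have key : ∀ {u y : V}, ¬ IsLight G v u → ∃ a, G.Adj v a ∧ G.Adj u a ∧ a ≠ y := by
    intro u y h
    simp only [IsLight, not_forall] at h
    obtain ⟨z, w, h₁, h₂, h₃, h₄, hne⟩ := h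
    by_cases hz : z = y
    · exact ⟨w, h₃, h₄, fun hw => hne (hz.trans hw.symm)⟩
    · exact ⟨z, h₁, h₂, hz⟩
  by_contra! h
  obtain ⟨a, hva, hxa, hay⟩ := key (y := y) h.1
  obtain ⟨d, hvd, hyd, hdx⟩ := key (y := x) h.2
  exact false_of_fan hP4 hK4 hvx hvy hxy hva hxa hay hvd hyd hdx

/-- Every triangle has a vertex whose two edges in the triangle are both light. -/
theorem exists_isLight_apex {V : Type*} {G : SimpleGraph V}
    (hP4 : ¬ Contains hatP4 G) (hK4 : ¬ Contains (⊤ : SimpleGraph (Fin 4)) G)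
    {T : Finset V} (hT : G.IsNClique 3 T) :
    ∃ a ∈ T, ∀ b ∈ T, b ≠ a → IsLight G a b := by
  classical
  obtain ⟨x, y, z, hxy, hxz, hyz, rfl⟩ := SimpleGraph.is3Clique_iff.1 hT
  have hx := isLight_or_isLight hP4 hK4 hxy hxz hyz
  have hy := isLight_or_isLight hP4 hK4 hxy.symm hyz hxz
  have hz := isLight_or_isLight hP4 hK4 hxz.symm hyz.symm hxy
  have s₁ := @IsLight.symm _ G x y
  have s₂ := @IsLight.symm _ G y x
  have s₃ := @IsLight.symm _ G x z
  have s₄ := @IsLight.symm _ G z x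
  have s₅ := @IsLight.symm _ G y z
  have s₆ := @IsLight.symm _ G z y
  simp only [Finset.mem_insert, Finset.mem_singleton, exists_eq_or_imp, exists_eq_left,
    forall_eq_or_imp, forall_eq, ne_eq, not_true_eq_false, false_imp_iff, true_and, and_true]
  tauto

/-- If an `n`-vertex graph `G` is `P̂₄`-free and contains no `K₄` as a subgraph,
then `G` has at most `⌊n² / 8⌋` triangles. -/
theorem stmt_10 {V : Type} [Fintype V] (G : SimpleGraph V)
    (hP4 : ¬ Contains hatP4 G) (hK4 : ¬ Contains (⊤ : SimpleGraph (Fin 4)) G) :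
    triangleCount G ≤ (Fintype.card V) ^ 2 / 8 := by
  classical
  rcases isEmpty_or_nonempty V with hV | hV
  · have h0 : G.cliqueSet 3 = ∅ := by
      refine Set.eq_empty_of_forall_notMem fun T hT => ?_
      obtain ⟨x, -⟩ := SimpleGraph.is3Clique_iff.1 hT
      exact hV.elim x
    simp [triangleCount, h0]
  choose! a haT hlight using fun T (hT : G.IsNClique 3 T) => exists_isLight_apex hP4 hK4 hT
  -- Deleting from each triangle the edge opposite its apex destroys all triangles.
  let H := G.deleteEdges {e | ∃ T, G.IsNClique 3 T ∧ ∃ x ∈ T, ∃ y ∈ T,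
    x ≠ a T ∧ y ≠ a T ∧ e = s(x, y)}
  have hHG : H ≤ G := G.deleteEdges_le _
  have hH : H.CliqueFree 3 := by
    intro T hTH
    have hT : G.IsNClique 3 T := hTH.mono hHG
    have hc : (T.erase (a T)).card = 2 := by
      rw [Finset.card_erase_of_mem (haT T hT), hT.card_eq]
    obtain ⟨x, y, hxy, hE⟩ := Finset.card_eq_two.1 hc
    have hx : x ∈ T.erase (a T) := by simp [hE]
    have hy : y ∈ T.erase (a T) := by simp [hE]
    rw [Finset.mem_erase] at hx hy
    have hadj := hTH.isClique hx.2 hy.2 hxy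
    exact (SimpleGraph.deleteEdges_adj.1 hadj).2 ⟨T, hT, x, hx.2, y, hy.2, hx.1, hy.1, rfl⟩
  -- The two edges at the apex survive, and each lies in a single triangle.
  have hcount : ((G.cliqueFinset 3).sigma fun T => T.erase (a T)).card ≤ H.edgeFinset.card := by
    refine Finset.card_le_card_of_injOn (fun p => s(a p.1, p.2)) ?_ ?_
    · rintro ⟨T, b⟩ hp
      simp only [Finset.coe_sigma, Set.mem_sigma_iff, Finset.mem_coe,
        SimpleGraph.mem_cliqueFinset_iff, Finset.mem_erase] at hp
      obtain ⟨hT, hba, hb⟩ := hp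
      simp only [Finset.mem_coe, SimpleGraph.mem_edgeFinset, SimpleGraph.mem_edgeSet]
      refine SimpleGraph.deleteEdges_adj.2 ⟨hT.isClique (haT T hT) hb hba.symm, ?_⟩
      rintro ⟨S, hS, x, hx, y, hy, hxa, hya, he⟩
      have hmem : a T ∈ S ∧ b ∈ S ∧ a T ≠ a S := by
        rcases Sym2.eq_iff.1 he with ⟨rfl, rfl⟩ | ⟨rfl, rfl⟩
        · exact ⟨hx, hy, hxa⟩
        · exact ⟨hy, hx, hya⟩
      exact hmem.2.2 (congrArg a ((hlight T hT b hb hba).eq_of_isNClique hba.symm hT hS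
        (haT T hT) hb hmem.1 hmem.2.1))
    · rintro ⟨T, b⟩ hp ⟨S, c⟩ hq h
      simp only [Finset.coe_sigma, Set.mem_sigma_iff, Finset.mem_coe,
        SimpleGraph.mem_cliqueFinset_iff, Finset.mem_erase] at hp hq h
      obtain ⟨hT, hba, hb⟩ := hp
      obtain ⟨hS, hca, hc⟩ := hq
      have hmem : a T ∈ S ∧ b ∈ S := by
        rcases Sym2.eq_iff.1 h with ⟨h₁, h₂⟩ | ⟨h₁, h₂⟩
        · exact ⟨h₁ ▸ haT S hS, h₂ ▸ hc⟩
        · exact ⟨h₁ ▸ hc, h₂ ▸ haT S hS⟩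
      obtain rfl := (hlight T hT b hb hba).eq_of_isNClique hba.symm hT hS
        (haT T hT) hb hmem.1 hmem.2
      rw [Sym2.congr_right.1 h]
  have hsum : ((G.cliqueFinset 3).sigma fun T => T.erase (a T)).card =
      2 * (G.cliqueFinset 3).card := by
    rw [Finset.card_sigma, Finset.sum_const_nat (m := 2), mul_comm]
    intro T hT
    rw [SimpleGraph.mem_cliqueFinset_iff] at hT
    rw [Finset.card_erase_of_mem (haT T hT), hT.card_eq]
  have hmantel : 4 * H.edgeFinset.card ≤ Fintype.card V ^ 2 := by
    have h₁ := hH.card_edgeFinset_le (r := 2)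
    dsimp only at h₁
    rw [← SimpleGraph.card_edgeFinset_turanGraph] at h₁
    have h₂ := SimpleGraph.mul_card_edgeFinset_turanGraph_le (n := Fintype.card V) (r := 2)
    lia
  have ht : triangleCount G = (G.cliqueFinset 3).card := by
    rw [triangleCount, ← SimpleGraph.coe_cliqueFinset, Set.ncard_coe_finset]
  rw [ht, Nat.le_div_iff_mul_le (by norm_num)]
  lia
end
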